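/- Every tree T with n ≥ 6 vertices and diameter greater than or equal to 4 satisfies S_k(T) ≤ n − 2 + 2k − 2k/n for every integer k with 1 ≤ k ≤ n. -/

import Mathlib

open Polynomial

namespace LapPaper

variable {V : Type} [Fintype V] [DecidableEq V]

/-- The multiset of Laplacian eigenvalues of `G` (with multiplicity), given as the
real roots of the characteristic polynomial of the Laplacian matrix `L = D - A`. -/
noncomputable def lapSpectrum (G : SimpleGraph V) [DecidableRel G.Adj] : Multiset ℝ :=
  (G.lapMatrix ℝ).charpoly.roots

/-- The average degree `d̄ = 2|E|/n` of a graph. -/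
noncomputable def avgDeg (G : SimpleGraph V) [DecidableRel G.Adj] : ℝ :=
  2 * G.edgeFinset.card / Fintype.card V

/-- The Laplacian energy `LE(G) = ∑_i |μ_i - d̄|`. -/
noncomputable def LE (G : SimpleGraph V) [DecidableRel G.Adj] : ℝ :=
  ((lapSpectrum G).map (fun x => |x - avgDeg G|)).sum

/-- `Sk G k` is the sum of the `k` largest Laplacian eigenvalues `μ_1 + ⋯ + μ_k` of `G`. -/
noncomputable def Sk (G : SimpleGraph V) [DecidableRel G.Adj] (k : ℕ) : ℝ :=
  ((((lapSpectrum G).sort (· ≤ ·)).reverse).take k).sum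

/-- The number `σ` of Laplacian eigenvalues of `G` strictly larger than the average degree. -/
noncomputable def sigma (G : SimpleGraph V) [DecidableRel G.Adj] : ℕ :=
  Multiset.card ((lapSpectrum G).filter (fun x => avgDeg G < x))

/-- The double star `T(a,b)` on `a + b + 2` vertices: vertex `0` is adjacent to vertex `1`
and to the `a` leaves `2, …, a+1`; vertex `1` is adjacent to the `b` leaves `a+2, …, a+b+1`. -/
def doubleStar (a b : ℕ) : SimpleGraph (Fin (a + b + 2)) :=
  SimpleGraph.fromRel (fun u v =>
    (u.1 = 0 ∧ v.1 = 1) ∨ (u.1 = 0 ∧ 2 ≤ v.1 ∧ v.1 < a + 2) ∨ (u.1 = 1 ∧ a + 2 ≤ v.1))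

noncomputable instance (a b : ℕ) : DecidableRel (doubleStar a b).Adj := Classical.decRel _

/-- The star on `n` vertices: vertex `0` is adjacent to all other vertices. -/
def starGraph (n : ℕ) : SimpleGraph (Fin n) :=
  SimpleGraph.fromRel (fun u _ => u.1 = 0)

noncomputable instance (n : ℕ) : DecidableRel (starGraph n).Adj := Classical.decRel _

end LapPaper

namespace LapPaper

section Framework

open Finset Matrix

variable {V : Type} [Fintype V] [DecidableEq V]

/-- The rows of `U` form an orthonormal basis of `V → ℝ`. -/
structure IsONB (U : V → V → ℝ) : Prop where
  row : ∀ i j, ∑ v, U i v * U j v = if i = j then 1 else 0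
  col : ∀ v w, ∑ i, U i v * U i w = if v = w then 1 else 0

theorem IsONB.parseval {U : V → V → ℝ} (hU : IsONB U) (x : V → ℝ) :
    ∑ i, (∑ v, U i v * x v) ^ 2 = ∑ v, x v ^ 2 := by
  have h : ∀ i, (∑ v, U i v * x v) ^ 2 = ∑ v, ∑ w, (U i v * U i w) * (x v * x w) := by
    intro i
    rw [sq, sum_mul_sum]
    refine sum_congr rfl fun v _ => sum_congr rfl fun w _ => by ring
  simp_rw [h]
  rw [sum_comm]
  refine sum_congr rfl fun v _ => ?_
  rw [sum_comm]
  simp_rw [← sum_mul, hU.col]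
  simp [sq]

theorem IsONB.sum_sq {U : V → V → ℝ} (hU : IsONB U) (i : V) : ∑ v, U i v ^ 2 = 1 := by
  simpa [sq] using hU.row i i

theorem exists_eigenONB (H : Matrix V V ℝ) (hH : H.IsHermitian) :
    IsONB (fun j v => hH.eigenvectorBasis j v) ∧
    ∀ x : V → ℝ, x ⬝ᵥ H *ᵥ x =
      ∑ j, hH.eigenvalues j * (∑ v, hH.eigenvectorBasis j v * x v) ^ 2 := by
  set u : Matrix V V ℝ := (hH.eigenvectorUnitary : Matrix V V ℝ) with hu
  have huv : ∀ v j, u v j = hH.eigenvectorBasis j v := fun v j => rfl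
  have h1 : uᵀ * u = 1 := by
    simpa [star_eq_conjTranspose] using Unitary.coe_star_mul_self hH.eigenvectorUnitary
  have h2 : u * uᵀ = 1 := by
    simpa [star_eq_conjTranspose] using Unitary.coe_mul_star_self hH.eigenvectorUnitary
  refine ⟨⟨fun i j => ?_, fun v w => ?_⟩, fun x => ?_⟩
  · have := congrFun (congrFun h1 i) j
    simpa only [mul_apply, one_apply, transpose_apply, huv] using this
  · have := congrFun (congrFun h2 v) w
    simpa only [mul_apply, one_apply, transpose_apply, huv] using this
  · have hs : H = u * diagonal hH.eigenvalues * uᵀ := by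
      conv_lhs => rw [hH.spectral_theorem]
      simp [Unitary.conjStarAlgAut_apply, star_eq_conjTranspose, hu]
    have : x ⬝ᵥ H *ᵥ x = (uᵀ *ᵥ x) ⬝ᵥ (diagonal hH.eigenvalues *ᵥ (uᵀ *ᵥ x)) := by
      conv_lhs => rw [hs]
      rw [← mulVec_mulVec, ← mulVec_mulVec, dotProduct_mulVec x, ← mulVec_transpose]
    rw [this]
    have hD : ∀ y : V → ℝ, y ⬝ᵥ (diagonal hH.eigenvalues *ᵥ y) =
        ∑ j, hH.eigenvalues j * y j ^ 2 := fun y => by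
      simp only [dotProduct, mulVec_diagonal]
      exact sum_congr rfl fun j _ => by ring
    rw [hD]
    simp only [mulVec, dotProduct, transpose_apply, huv]

/-- The quadratic function `q` has trace `t`. -/
def HasTr (q : (V → ℝ) → ℝ) (t : ℝ) : Prop :=
  ∀ U, IsONB U → ∑ i, q (U i) = t

namespace HasTr

variable {q q' : (V → ℝ) → ℝ} {t t' : ℝ}

theorem add (h : HasTr q t) (h' : HasTr q' t') : HasTr (fun x => q x + q' x) (t + t') :=
  fun U hU => by simp only [sum_add_distrib, h U hU, h' U hU]

theorem const_mul (c : ℝ) (h : HasTr q t) : HasTr (fun x => c * q x) (c * t) :=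
  fun U hU => by simp only [← mul_sum, h U hU]

theorem sub (h : HasTr q t) (h' : HasTr q' t') : HasTr (fun x => q x - q' x) (t - t') :=
  fun U hU => by simp only [sum_sub_distrib, h U hU, h' U hU]

theorem sum {ι : Type*} (s : Finset ι) {q : ι → (V → ℝ) → ℝ} {t : ι → ℝ}
    (h : ∀ i ∈ s, HasTr (q i) (t i)) : HasTr (fun x => ∑ i ∈ s, q i x) (∑ i ∈ s, t i) :=
  fun U hU => by
    rw [sum_comm]
    exact sum_congr rfl fun i hi => h i hi U hU

theorem congr (h : HasTr q t) (hq : ∀ x, q' x = q x) (ht : t' = t) : HasTr q' t' := by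
  subst ht
  intro U hU
  simp only [hq, h U hU]

theorem apply_mul_apply (v w : V) : HasTr (fun x => x v * x w) (if v = w then 1 else 0) :=
  fun _ hU => hU.col v w

theorem sum_mul_sum (A B : Finset V) :
    HasTr (fun x => (∑ a ∈ A, x a) * ∑ b ∈ B, x b) (A ∩ B).card := by
  have := HasTr.sum A (fun a _ => HasTr.sum B (fun b _ => apply_mul_apply a b))
  refine this.congr (fun x => Finset.sum_mul_sum _ _ _ _) ?_
  simp [Finset.sum_ite_eq]

theorem sum_sq (A : Finset V) : HasTr (fun x => ∑ a ∈ A, x a ^ 2) A.card := by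
  have := HasTr.sum A (fun a _ => apply_mul_apply a a)
  refine this.congr (fun x => sum_congr rfl fun a _ => sq _) (by simp)

end HasTr

section Forms

variable (G : SimpleGraph V) [DecidableRel G.Adj]

/-- The Laplacian quadratic form of the subgraph of `G` induced on `S`. -/
noncomputable def energy (S : Finset V) (x : V → ℝ) : ℝ :=
  (∑ a ∈ S, ∑ b ∈ S, if G.Adj a b then (x a - x b) ^ 2 else 0) / 2

/-- The part of the Laplacian quadratic form coming from the edges between `S` and `S'`. -/
noncomputable def crossEnergy (S S' : Finset V) (x : V → ℝ) : ℝ :=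
  ∑ a ∈ S, ∑ b ∈ S', if G.Adj a b then (x a - x b) ^ 2 else 0

/-- The number of edges of the subgraph of `G` induced on `S`. -/
noncomputable def edgeCount (S : Finset V) : ℝ :=
  (∑ a ∈ S, ∑ b ∈ S, if G.Adj a b then 1 else 0) / 2

/-- The number of edges between `S` and `S'`. -/
noncomputable def crossCount (S S' : Finset V) : ℝ :=
  ∑ a ∈ S, ∑ b ∈ S', if G.Adj a b then 1 else 0

omit [Fintype V] in
theorem energy_union {S S' : Finset V} (h : Disjoint S S') (x : V → ℝ) :
    energy G (S ∪ S') x = energy G S x + energy G S' x + crossEnergy G S S' x := by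
  have h' : ∑ a ∈ S', ∑ b ∈ S, (if G.Adj a b then (x a - x b) ^ 2 else 0)
      = crossEnergy G S S' x := by
    rw [sum_comm, crossEnergy]
    refine sum_congr rfl fun a _ => sum_congr rfl fun b _ => ?_
    simp only [G.adj_comm b a, sub_sq_comm (x b)]
  unfold energy
  rw [sum_union h]
  simp_rw [sum_union h, sum_add_distrib]
  rw [h', crossEnergy]
  ring

omit [Fintype V] in
theorem edgeCount_union {S S' : Finset V} (h : Disjoint S S') :
    edgeCount G (S ∪ S') = edgeCount G S + edgeCount G S' + crossCount G S S' := by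
  have h' : ∑ a ∈ S', ∑ b ∈ S, (if G.Adj a b then (1 : ℝ) else 0)
      = crossCount G S S' := by
    rw [sum_comm, crossCount]
    refine sum_congr rfl fun a _ => sum_congr rfl fun b _ => ?_
    simp only [G.adj_comm b a]
  unfold edgeCount
  rw [sum_union h]
  simp_rw [sum_union h, sum_add_distrib]
  rw [h', crossCount]
  ring

omit [Fintype V] [DecidableEq V] in
theorem energy_nonneg (S : Finset V) (x : V → ℝ) : 0 ≤ energy G S x := by
  unfold energy
  refine div_nonneg (sum_nonneg fun a _ => sum_nonneg fun b _ => ?_) (by norm_num)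
  split_ifs <;> positivity

omit [Fintype V] [DecidableEq V] in
theorem crossEnergy_nonneg (S S' : Finset V) (x : V → ℝ) : 0 ≤ crossEnergy G S S' x := by
  unfold crossEnergy
  refine sum_nonneg fun a _ => sum_nonneg fun b _ => ?_
  split_ifs <;> positivity

omit [Fintype V] [DecidableEq V] in
theorem sum_le_crossEnergy {S S' P : Finset V} (f : V → V) (hP : P ⊆ S)
    (hf : ∀ a ∈ P, f a ∈ S' ∧ G.Adj a (f a)) (x : V → ℝ) :
    ∑ a ∈ P, (x a - x (f a)) ^ 2 ≤ crossEnergy G S S' x := by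
  have h0 : ∀ a b, 0 ≤ if G.Adj a b then (x a - x b) ^ 2 else 0 := by
    intro a b
    split_ifs <;> positivity
  unfold crossEnergy
  refine le_trans ?_ (sum_le_sum_of_subset_of_nonneg hP fun a _ _ => sum_nonneg fun b _ => h0 a b)
  refine sum_le_sum fun a ha => ?_
  refine le_trans (le_of_eq ?_)
    (single_le_sum (f := fun b => if G.Adj a b then (x a - x b) ^ 2 else 0)
      (fun b _ => h0 a b) (hf a ha).1)
  simp [(hf a ha).2]

omit [Fintype V] [DecidableEq V] in
theorem sq_sub_le_crossEnergy {S S' : Finset V} {a b : V} (ha : a ∈ S) (hb : b ∈ S')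
    (hab : G.Adj a b) (x : V → ℝ) : (x a - x b) ^ 2 ≤ crossEnergy G S S' x := by
  have := sum_le_crossEnergy G (P := {a}) (fun _ => b) (S := S) (S' := S') (by simpa) (by simp [hb, hab]) x
  simpa using this

theorem exists_matrix_energy (S : Finset V) :
    ∃ H : Matrix V V ℝ, H.IsHermitian ∧
      ∀ x : V → ℝ, x ⬝ᵥ H *ᵥ x = energy G S x - 2 * ∑ v ∈ S, x v ^ 2 := by
  classical
  let G' : SimpleGraph V :=
    { Adj := fun a b => G.Adj a b ∧ a ∈ S ∧ b ∈ S
      symm := ⟨fun a b h => ⟨h.1.symm, h.2.2, h.2.1⟩⟩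
      loopless := ⟨fun a h => G.loopless.irrefl a h.1⟩ }
  refine ⟨G'.lapMatrix ℝ - diagonal (fun v => if v ∈ S then 2 else 0), ?_, fun x => ?_⟩
  · refine (G'.isHermitian_lapMatrix ℝ).sub ?_
    exact isHermitian_diagonal_iff.mpr (fun v => by simp [IsSelfAdjoint])
  · rw [sub_mulVec, dotProduct_sub]
    have h1 := G'.lapMatrix_toLinearMap₂' ℝ x
    rw [toLinearMap₂'_apply'] at h1
    rw [h1]
    congr 1
    · unfold energy
      congr 1
      rw [← sum_filter_add_sum_filter_not univ (· ∈ S)]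
      rw [sum_eq_zero (s := filter (fun a => ¬ a ∈ S) univ), add_zero]
      · simp only [filter_mem_eq_inter, univ_inter]
        refine sum_congr rfl fun a ha => ?_
        rw [← sum_filter_add_sum_filter_not univ (· ∈ S)]
        rw [sum_eq_zero (s := filter (fun a => ¬ a ∈ S) univ), add_zero]
        · simp only [filter_mem_eq_inter, univ_inter]
          refine sum_congr rfl fun b hb => ?_
          simp [G', ha, hb]
        · intro b hb
          simp only [mem_filter] at hb
          simp [G', hb.2]
      · intro a ha
        simp only [mem_filter] at ha
        simp [G', ha.2]
    · simp only [dotProduct, mulVec_diagonal]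
      rw [mul_sum]
      simp only [ite_mul, zero_mul, mul_ite, mul_zero]
      rw [sum_ite_mem]
      simp only [univ_inter]
      exact sum_congr rfl fun v _ => by ring

theorem hasTr_energy (S : Finset V) : HasTr (energy G S) (2 * edgeCount G S) := by
  have h : ∀ a b : V, HasTr (fun x => if G.Adj a b then (x a - x b) ^ 2 else 0)
      (if G.Adj a b then 2 else 0) := by
    intro a b
    by_cases hab : G.Adj a b
    · have hne := G.ne_of_adj hab
      have := ((HasTr.apply_mul_apply a a).add (HasTr.apply_mul_apply b b)).sub
        ((HasTr.apply_mul_apply a b).const_mul 2)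
      simp only [hab, if_true]
      refine this.congr (fun x => by ring) ?_
      simp [hne]
      norm_num
    · simpa [hab] using (HasTr.apply_mul_apply a a).const_mul 0
  have := (HasTr.sum S fun a _ => HasTr.sum S fun b _ => h a b).const_mul (1 / 2)
  refine this.congr (fun x => by unfold energy; ring) ?_
  unfold edgeCount
  simp only [mul_sum, sum_div]
  refine sum_congr rfl fun a _ => sum_congr rfl fun b _ => ?_
  split_ifs <;> norm_num

end Forms

end Framework

section Bounds

open Finset Matrix

variable {V : Type} [Fintype V] [DecidableEq V] (G : SimpleGraph V) [DecidableRel G.Adj]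

/-- Every partial trace of the form `energy - 2 ∑ x²` on `S` is at most
`2 e(S) - |S| - g`. -/
def GainBound (S : Finset V) (g : ℝ) : Prop :=
  ∀ U, IsONB U → ∀ I : Finset V,
    ∑ i ∈ I, (energy G S (U i) - 2 * ∑ v ∈ S, U i v ^ 2) ≤ 2 * edgeCount G S - S.card - g

/-- The induced subgraph on `S` contains a matching of size `p`. -/
def HasMatching (S : Finset V) (p : ℕ) : Prop :=
  ∃ (P : Finset V) (f : V → V), P ⊆ S ∧ P.card = p ∧ Set.InjOn f P ∧
    ∀ a ∈ P, f a ∈ S \ P ∧ G.Adj a (f a)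

/-- A nonnegative form of trace `t` which, added to the energy, dominates `s ∑ x²` on `S`. -/
def HasCert (S : Finset V) (s t : ℝ) : Prop :=
  ∃ q : (V → ℝ) → ℝ, (∀ x, 0 ≤ q x) ∧ HasTr q t ∧
    ∀ x, s * ∑ v ∈ S, x v ^ 2 ≤ energy G S x + q x

variable {G}

theorem GainBound.mono {S : Finset V} {g g' : ℝ} (h : GainBound G S g) (hg : g' ≤ g) :
    GainBound G S g' := fun U hU I => (h U hU I).trans (by linarith)

theorem IsONB.sum_sub_sq_le {U : V → V → ℝ} (hU : IsONB U) (I : Finset V) {a b : V}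
    (hab : a ≠ b) : ∑ i ∈ I, (U i a - U i b) ^ 2 ≤ 2 := by
  refine (sum_le_sum_of_subset_of_nonneg (subset_univ I) fun i _ _ => sq_nonneg _).trans ?_
  have h : ∀ i, (U i a - U i b) ^ 2 = U i a * U i a + U i b * U i b - 2 * (U i a * U i b) :=
    fun i => by ring
  simp_rw [h, sum_sub_distrib, sum_add_distrib, ← mul_sum, hU.col]
  simp [hab]
  norm_num

theorem IsONB.sum_crossEnergy_le {U : V → V → ℝ} (hU : IsONB U) (I S S' : Finset V) :
    ∑ i ∈ I, crossEnergy G S S' (U i) ≤ 2 * crossCount G S S' := by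
  unfold crossEnergy crossCount
  rw [sum_comm, mul_sum]
  refine sum_le_sum fun a _ => ?_
  rw [sum_comm, mul_sum]
  refine sum_le_sum fun b _ => ?_
  by_cases hab : G.Adj a b
  · simpa [hab] using hU.sum_sub_sq_le I (G.ne_of_adj hab)
  · simp [hab]

theorem GainBound.union {S S' : Finset V} {g g' : ℝ} (h : GainBound G S g)
    (h' : GainBound G S' g') (hd : Disjoint S S') : GainBound G (S ∪ S') (g + g') := by
  intro U hU I
  have h1 := h U hU I
  have h2 := h' U hU I
  have h3 := hU.sum_crossEnergy_le (G := G) I S S'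
  have h4 : ∀ i, energy G (S ∪ S') (U i) - 2 * ∑ v ∈ S ∪ S', U i v ^ 2 =
      (energy G S (U i) - 2 * ∑ v ∈ S, U i v ^ 2) +
      (energy G S' (U i) - 2 * ∑ v ∈ S', U i v ^ 2) + crossEnergy G S S' (U i) := by
    intro i
    rw [energy_union G hd, sum_union hd]
    ring
  simp_rw [h4, sum_add_distrib]
  rw [edgeCount_union G hd, card_union_of_disjoint hd]
  push_cast
  linarith

omit [Fintype V] [DecidableRel G.Adj] in
theorem HasMatching.union {S S' : Finset V} {p p' : ℕ} (h : HasMatching G S p)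
    (h' : HasMatching G S' p') (hd : Disjoint S S') : HasMatching G (S ∪ S') (p + p') := by
  obtain ⟨P, f, hP, rfl, hf, hfa⟩ := h
  obtain ⟨P', f', hP', rfl, hf', hfa'⟩ := h'
  have hPP' : Disjoint P P' := hd.mono hP hP'
  have hd1 : ∀ a ∈ S, a ∉ S' := fun a ha => Finset.disjoint_left.1 hd ha
  have e1 : ∀ a ∈ P, (if a ∈ P then f a else f' a) = f a := fun a ha => by simp [ha]
  have e2 : ∀ a ∈ P', (if a ∈ P then f a else f' a) = f' a := fun a ha => by
    simp [Finset.disjoint_right.1 hPP' ha]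
  refine ⟨P ∪ P', fun a => if a ∈ P then f a else f' a, union_subset_union hP hP',
    card_union_of_disjoint hPP', ?_, ?_⟩
  · intro a ha b hb hab
    simp only [coe_union, Set.mem_union, mem_coe] at ha hb
    dsimp only at hab
    rcases ha with ha | ha <;> rcases hb with hb | hb
    · rw [e1 a ha, e1 b hb] at hab
      exact hf ha hb hab
    · rw [e1 a ha, e2 b hb] at hab
      have := (mem_sdiff.1 (hfa a ha).1).1
      exact absurd (hab ▸ (mem_sdiff.1 (hfa' b hb).1).1) (hd1 _ this)
    · rw [e2 a ha, e1 b hb] at hab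
      have := (mem_sdiff.1 (hfa b hb).1).1
      exact absurd (hab ▸ (mem_sdiff.1 (hfa' a ha).1).1) (hd1 _ this)
    · rw [e2 a ha, e2 b hb] at hab
      exact hf' ha hb hab
  · intro a ha
    dsimp only
    rcases mem_union.1 ha with ha | ha
    · rw [e1 a ha]
      obtain ⟨h1, h2⟩ := hfa a ha
      rw [mem_sdiff] at h1
      refine ⟨?_, h2⟩
      simp only [mem_sdiff, mem_union, h1.1, h1.2, true_or, false_or, true_and]
      exact fun h => hd1 _ h1.1 (hP' h)
    · rw [e2 a ha]
      obtain ⟨h1, h2⟩ := hfa' a ha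
      rw [mem_sdiff] at h1
      refine ⟨?_, h2⟩
      simp only [mem_sdiff, mem_union, h1.1, h1.2, or_true, or_false, true_and]
      exact fun h => hd1 _ (hP h) h1.1

theorem HasCert.union {S S' : Finset V} {s t t' : ℝ} (h : HasCert G S s t)
    (h' : HasCert G S' s t') (hd : Disjoint S S') : HasCert G (S ∪ S') s (t + t') := by
  obtain ⟨q, hq, ht, hs⟩ := h
  obtain ⟨q', hq', ht', hs'⟩ := h'
  refine ⟨_, fun x => add_nonneg (hq x) (hq' x), ht.add ht', fun x => ?_⟩
  have := hs x
  have := hs' x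
  have := crossEnergy_nonneg G S S' x
  rw [energy_union G hd, sum_union hd]
  linarith

omit [Fintype V] in
theorem HasMatching.form_nonneg {S P : Finset V} {f : V → V} (hP : P ⊆ S)
    (hf : Set.InjOn f P) (hfa : ∀ a ∈ P, f a ∈ S \ P ∧ G.Adj a (f a)) (x : V → ℝ)
    (hx : ∀ v ∈ S \ P, x v + ∑ a ∈ P, (if f a = v then x a else 0) = 0) :
    0 ≤ energy G S x - 2 * ∑ v ∈ S, x v ^ 2 := by
  have hd : Disjoint P (S \ P) := disjoint_sdiff
  have hu : P ∪ S \ P = S := union_sdiff_of_subset hP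
  have h1 := energy_union G hd x
  rw [hu] at h1
  have h2 := sum_le_crossEnergy G f (Subset.refl P) hfa x
  have h3 := energy_nonneg G P x
  have h4 := energy_nonneg G (S \ P) x
  have h5 : ∑ v ∈ S, x v ^ 2 = ∑ v ∈ P, x v ^ 2 + ∑ v ∈ S \ P, x v ^ 2 := by
    rw [← sum_union hd, hu]
  have h6 : ∀ a ∈ P, x (f a) = - x a := by
    intro a ha
    have := hx _ (hfa a ha).1
    rw [sum_eq_single a] at this
    · simp at this
      linarith
    · intro b hb hba
      rw [if_neg]
      exact fun h => hba (hf hb ha h)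
    · exact fun h => absurd ha h
  have h7 : ∑ v ∈ S \ P, x v ^ 2 = ∑ a ∈ P, x a ^ 2 := by
    rw [← sum_subset (s₁ := P.image f) (s₂ := S \ P)]
    · rw [sum_image hf]
      refine sum_congr rfl fun a ha => ?_
      rw [h6 a ha]
      ring
    · intro v hv
      obtain ⟨a, ha, rfl⟩ := mem_image.1 hv
      exact (hfa a ha).1
    · intro v hv hv'
      have := hx v hv
      rw [sum_eq_zero] at this
      · rw [add_zero] at this
        rw [this]
        ring
      · intro a ha
        rw [if_neg]
        rintro rfl
        exact hv' (mem_image_of_mem f ha)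
  have h8 : ∑ a ∈ P, (x a - x (f a)) ^ 2 = 4 * ∑ a ∈ P, x a ^ 2 := by
    rw [mul_sum]
    refine sum_congr rfl fun a ha => ?_
    rw [h6 a ha]
    ring
  linarith

theorem IsONB.form_combination {e : V → V → ℝ} (he : IsONB e) {lam : V → ℝ} {h : (V → ℝ) → ℝ}
    (hh : ∀ x : V → ℝ, h x = ∑ j, lam j * (∑ v, e j v * x v) ^ 2) (c : V → ℝ) :
    h (fun v => ∑ j, c j * e j v) = ∑ j, lam j * c j ^ 2 := by
  rw [hh]
  refine sum_congr rfl fun j _ => ?_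
  congr 2
  simp_rw [mul_sum]
  rw [sum_comm]
  have : ∀ k, ∑ v, e j v * (c k * e k v) = c k * ∑ v, e j v * e k v := fun k => by
    rw [mul_sum]
    exact sum_congr rfl fun v _ => by ring
  simp_rw [this, he.row]
  simp

theorem HasMatching.card_neg_le {S : Finset V} {p : ℕ} (hM : HasMatching G S p)
    {e : V → V → ℝ} (he : IsONB e) {lam : V → ℝ}
    (hh : ∀ x : V → ℝ, energy G S x - 2 * ∑ v ∈ S, x v ^ 2 =
      ∑ j, lam j * (∑ v, e j v * x v) ^ 2) :
    (univ.filter fun j => lam j < 0).card + p ≤ S.card := by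
  obtain ⟨P, f, hP, rfl, hf, hfa⟩ := hM
  set K := univ.filter fun j => lam j < 0 with hK
  by_contra hlt
  push Not at hlt
  let Y : (K → ℝ) →ₗ[ℝ] (V → ℝ) :=
    { toFun := fun c v => ∑ j : K, c j * e j v
      map_add' := fun c d => by ext v; simp [add_mul, sum_add_distrib]
      map_smul' := fun r c => by ext v; simp [mul_assoc, mul_sum] }
  let Φ : (K → ℝ) →ₗ[ℝ] ((S \ P : Finset V) → ℝ) :=
    { toFun := fun c v => Y c v + ∑ a ∈ P, (if f a = v then Y c a else 0)
      map_add' := fun c d => by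
        ext v
        simp only [map_add, Pi.add_apply]
        have : ∀ a, (if f a = v then Y c a + Y d a else 0) =
          (if f a = v then Y c a else 0) + (if f a = v then Y d a else 0) := fun a => by
            split_ifs <;> simp
        simp_rw [this, sum_add_distrib]
        ring
      map_smul' := fun r c => by
        ext v
        simp only [map_smul, Pi.smul_apply, smul_eq_mul, RingHom.id_apply, mul_add, mul_sum,
          mul_ite, mul_zero] }
  have hker : LinearMap.ker Φ ≠ ⊥ := by
    apply LinearMap.ker_ne_bot_of_finrank_lt
    simp only [Module.finrank_fintype_fun_eq_card, Fintype.card_coe]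
    have := card_sdiff_add_card_eq_card hP
    omega
  obtain ⟨c, hc, hc0⟩ := (Submodule.ne_bot_iff _).1 hker
  have hc' : Φ c = 0 := hc
  have h0 := HasMatching.form_nonneg hP hf hfa (Y c) (fun v hv => congrFun hc' ⟨v, hv⟩)
  let c' : V → ℝ := fun j => if hj : j ∈ K then c ⟨j, hj⟩ else 0
  have hY : Y c = fun v => ∑ j, c' j * e j v := by
    ext v
    rw [← sum_subset (subset_univ K)]
    · rw [← sum_coe_sort K]
      refine sum_congr rfl fun j _ => ?_
      simp [c', j.2]
    · intro j _ hj
      simp [c', hj]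
  rw [hY, he.form_combination (h := fun x => energy G S x - 2 * ∑ v ∈ S, x v ^ 2) hh] at h0
  have hneg : ∑ j, lam j * c' j ^ 2 < 0 := by
    obtain ⟨j, hj⟩ := Function.ne_iff.1 hc0
    apply sum_neg'
    · intro i _
      by_cases hi : i ∈ K
      · exact mul_nonpos_of_nonpos_of_nonneg (mem_filter.1 hi).2.le (sq_nonneg _)
      · simp [c', hi]
    · refine ⟨j, mem_univ _, ?_⟩
      have : c' j = c j := by simp [c', j.2]
      have hj : c j ≠ 0 := hj
      rw [this]
      exact mul_neg_of_neg_of_pos (mem_filter.1 j.2).2 (by positivity)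
  linarith

theorem HasCert.gainBound {S : Finset V} {s t : ℝ} {p : ℕ} (hC : HasCert G S s t) (hs : s ≤ 2)
    (hM : HasMatching G S p) :
    GainBound G S ((s - 1) * S.card + (2 - s) * p - t) := by
  obtain ⟨q, hq, ht, hsq⟩ := hC
  obtain ⟨H, hH, hHx⟩ := exists_matrix_energy G S
  obtain ⟨he, hform⟩ := exists_eigenONB H hH
  set e : V → V → ℝ := fun j v => hH.eigenvectorBasis j v
  set lam := hH.eigenvalues
  have hh : ∀ x : V → ℝ, energy G S x - 2 * ∑ v ∈ S, x v ^ 2 =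
      ∑ j, lam j * (∑ v, e j v * x v) ^ 2 := fun x => by rw [← hHx, hform]
  have hcard := hM.card_neg_le he hh
  set K := univ.filter fun j => lam j < 0 with hK
  have hlam : ∀ j, lam j = energy G S (e j) - 2 * ∑ v ∈ S, e j v ^ 2 := by
    intro j
    rw [hh]
    simp_rw [he.row]
    simp
  intro U hU I
  have hmain : ∑ i ∈ I, (energy G S (U i) - 2 * ∑ v ∈ S, U i v ^ 2) ≤ ∑ j ∈ Kᶜ, lam j := by
    simp_rw [hh]
    rw [sum_comm]
    simp_rw [← mul_sum]
    rw [← sum_add_sum_compl K]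
    have h1 : ∀ j, ∑ i ∈ I, (∑ v, e j v * U i v) ^ 2 ≤ 1 := by
      intro j
      have := hU.parseval (e j)
      rw [he.sum_sq] at this
      rw [← this]
      refine (sum_le_sum_of_subset_of_nonneg (subset_univ I) fun i _ _ => sq_nonneg _).trans ?_
      exact le_of_eq (sum_congr rfl fun i _ => by simp_rw [mul_comm])
    have h2 : ∀ j, 0 ≤ ∑ i ∈ I, (∑ v, e j v * U i v) ^ 2 :=
      fun j => sum_nonneg fun i _ => sq_nonneg _
    have h3 : ∑ j ∈ K, lam j * ∑ i ∈ I, (∑ v, e j v * U i v) ^ 2 ≤ 0 :=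
      sum_nonpos fun j hj => mul_nonpos_of_nonpos_of_nonneg (mem_filter.1 hj).2.le (h2 j)
    have h4 : ∑ j ∈ Kᶜ, lam j * ∑ i ∈ I, (∑ v, e j v * U i v) ^ 2 ≤ ∑ j ∈ Kᶜ, lam j := by
      refine sum_le_sum fun j hj => ?_
      have : 0 ≤ lam j := by
        by_contra h
        exact (mem_compl.1 hj) (mem_filter.2 ⟨mem_univ _, lt_of_not_ge h⟩)
      nlinarith [h1 j]
    linarith
  refine hmain.trans ?_
  simp_rw [hlam, sum_sub_distrib, ← mul_sum]
  have hE := hasTr_energy G S e he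
  have hms := HasTr.sum_sq S e he
  have hqe := ht e he
  rw [← sum_add_sum_compl K] at hE hms hqe
  have hK1 : s * ∑ j ∈ K, ∑ v ∈ S, e j v ^ 2 ≤ ∑ j ∈ K, energy G S (e j) + ∑ j ∈ K, q (e j) := by
    rw [mul_sum, ← sum_add_distrib]
    exact sum_le_sum fun j _ => hsq (e j)
  have hK2 : 0 ≤ ∑ j ∈ Kᶜ, q (e j) := sum_nonneg fun j _ => hq _
  have hK3 : ∑ j ∈ K, ∑ v ∈ S, e j v ^ 2 ≤ K.card := by
    have : ∑ j ∈ K, ∑ v ∈ S, e j v ^ 2 ≤ ∑ j ∈ K, (1 : ℝ) := by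
      refine sum_le_sum fun j _ => ?_
      rw [← he.sum_sq j]
      exact sum_le_sum_of_subset_of_nonneg (subset_univ S) fun i _ _ => sq_nonneg _
    simpa using this
  have hcard' : (K.card : ℝ) + p ≤ S.card := by exact_mod_cast hcard
  have h5 : (2 - s) * (p : ℝ) ≤ (2 - s) * ∑ j ∈ Kᶜ, ∑ v ∈ S, e j v ^ 2 :=
    mul_le_mul_of_nonneg_left (by linarith) (by linarith)
  nlinarith

end Bounds

section Stars

open Finset Matrix

variable {V : Type} [Fintype V] [DecidableEq V] {G : SimpleGraph V} [DecidableRel G.Adj]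

omit [Fintype V] [DecidableRel G.Adj] in
theorem HasMatching.mono {S S' : Finset V} {p : ℕ} (h : HasMatching G S p) (hS : S ⊆ S') :
    HasMatching G S' p := by
  obtain ⟨P, f, hP, hp, hf, hfa⟩ := h
  refine ⟨P, f, hP.trans hS, hp, hf, fun a ha => ⟨?_, (hfa a ha).2⟩⟩
  exact sdiff_subset_sdiff hS (Subset.refl _) (hfa a ha).1

/-- A star subgraph of `G` with at least one leaf. -/
structure Star (G : SimpleGraph V) where
  /-- The centre. -/
  ctr : V
  /-- The leaves. -/
  leaves : Finset V
  nonempty : leaves.Nonempty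
  ctr_notMem : ctr ∉ leaves
  adj : ∀ l ∈ leaves, G.Adj ctr l

namespace Star

/-- The vertex set of a star. -/
def verts (X : Star G) : Finset V := insert X.ctr X.leaves

/-- The mean of `x` over a star. -/
noncomputable def mean (X : Star G) (x : V → ℝ) : ℝ := (∑ v ∈ X.verts, x v) / X.verts.card

/-- A vertex which is the centre of the star, for a suitable choice of the centre. -/
def IsHub (X : Star G) (v : V) : Prop := v = X.ctr ∨ (v ∈ X.leaves ∧ X.leaves.card = 1)

omit [Fintype V] [DecidableRel G.Adj]

theorem ctr_mem (X : Star G) : X.ctr ∈ X.verts := mem_insert_self _ _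

theorem leaves_subset (X : Star G) : X.leaves ⊆ X.verts := subset_insert _ _

theorem card_verts (X : Star G) : X.verts.card = X.leaves.card + 1 :=
  card_insert_of_notMem X.ctr_notMem

theorem two_le_card (X : Star G) : 2 ≤ X.verts.card := by
  have := X.nonempty.card_pos
  rw [card_verts]
  omega

theorem two_le_cast (X : Star G) : (2 : ℝ) ≤ X.verts.card := by exact_mod_cast X.two_le_card

theorem cast_pos (X : Star G) : (0 : ℝ) < X.verts.card := by linarith [X.two_le_cast]

theorem hasMatching (X : Star G) : HasMatching G X.verts 1 := by
  obtain ⟨l, hl⟩ := X.nonempty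
  refine ⟨{X.ctr}, fun _ => l, by simpa using X.ctr_mem, by simp, by simp, ?_⟩
  simp only [mem_singleton, forall_eq, mem_sdiff]
  exact ⟨⟨X.leaves_subset hl, fun h => X.ctr_notMem (h ▸ hl)⟩, X.adj l hl⟩

theorem IsHub.mem {X : Star G} {v : V} (h : X.IsHub v) : v ∈ X.verts := by
  rcases h with rfl | h
  · exact X.ctr_mem
  · exact X.leaves_subset h.1

theorem isHub_of_card_eq_two {X : Star G} {v : V} (hv : v ∈ X.verts) (h : X.verts.card = 2) :
    X.IsHub v := by
  rw [card_verts] at h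
  rcases mem_insert.1 hv with rfl | hv
  · exact Or.inl rfl
  · exact Or.inr ⟨hv, by omega⟩

theorem IsHub.exists_recenter {X : Star G} {v : V} (h : X.IsHub v) :
    ∃ Y : Star G, Y.ctr = v ∧ Y.verts = X.verts := by
  rcases h with rfl | ⟨hv, hc⟩
  · exact ⟨X, rfl, rfl⟩
  · obtain ⟨l, hl⟩ := card_eq_one.1 hc
    have hvl : v = l := by simpa [hl] using hv
    subst hvl
    have hne : X.ctr ≠ v := fun h => X.ctr_notMem (h ▸ hv)
    refine ⟨⟨v, {X.ctr}, by simp, by simpa using hne.symm, ?_⟩, rfl, ?_⟩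
    · simpa using (X.adj v hv).symm
    · simp only [verts, hl]
      exact pair_comm _ _

theorem sum_le_energy [DecidableRel G.Adj] (X : Star G) (x : V → ℝ) :
    ∑ l ∈ X.leaves, (x l - x X.ctr) ^ 2 ≤ energy G X.verts x := by
  have hd : Disjoint X.leaves {X.ctr} := by simpa using X.ctr_notMem
  have h1 := energy_union G hd x
  have h2 := sum_le_crossEnergy G (S' := {X.ctr}) (fun _ => X.ctr) (Subset.refl X.leaves)
    (fun a ha => ⟨by simp, (X.adj a ha).symm⟩) x
  have h3 := energy_nonneg G X.leaves x
  have h4 := energy_nonneg G {X.ctr} x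
  have h5 : X.leaves ∪ {X.ctr} = X.verts := by rw [union_comm]; rfl
  rw [h5] at h1
  linarith

theorem sum_verts (X : Star G) (x : V → ℝ) :
    ∑ v ∈ X.verts, x v = x X.ctr + ∑ v ∈ X.leaves, x v := sum_insert X.ctr_notMem

theorem sum_leaves_sub (X : Star G) (x : V → ℝ) :
    ∑ l ∈ X.leaves, (x l - x X.ctr) = - X.verts.card * (x X.ctr - X.mean x) := by
  have h := X.cast_pos.ne'
  have h1 : (X.verts.card : ℝ) * X.mean x = ∑ v ∈ X.verts, x v := by
    unfold mean
    field_simp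
  have h2 : (X.verts.card : ℝ) = X.leaves.card + 1 := by exact_mod_cast X.card_verts
  rw [sum_sub_distrib, sum_const, nsmul_eq_mul]
  rw [sum_verts] at h1
  linear_combination x X.ctr * h2 - h1

/-- Steiner's identity relative to the centre. -/
theorem sum_sq_eq (X : Star G) (x : V → ℝ) :
    ∑ v ∈ X.verts, x v ^ 2 = X.verts.card * X.mean x ^ 2 +
      ∑ l ∈ X.leaves, (x l - x X.ctr) ^ 2 - X.verts.card * (x X.ctr - X.mean x) ^ 2 := by
  have h := X.sum_leaves_sub x
  have h2 : (X.verts.card : ℝ) = X.leaves.card + 1 := by exact_mod_cast X.card_verts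
  have h3 : ∀ l, x l ^ 2 = (x l - x X.ctr) ^ 2 + 2 * x X.ctr * (x l - x X.ctr) + x X.ctr ^ 2 :=
    fun l => by ring
  rw [sum_verts X (fun v => x v ^ 2), sum_congr rfl (fun l _ => h3 l), sum_add_distrib,
    sum_add_distrib, ← mul_sum, h, sum_const, nsmul_eq_mul]
  linear_combination (-x X.ctr ^ 2) * h2

theorem sum_sq_le [DecidableRel G.Adj] (X : Star G) (x : V → ℝ) :
    ∑ v ∈ X.verts, x v ^ 2 + X.verts.card * (x X.ctr - X.mean x) ^ 2 ≤
      energy G X.verts x + X.verts.card * X.mean x ^ 2 := by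
  have := X.sum_sq_eq x
  have := X.sum_le_energy x
  linarith

/-- On a star with two vertices, the deviations at the two vertices are opposite. -/
theorem IsHub.sub_mean_of_ne_ctr {X : Star G} {v : V} (h : X.IsHub v) (hv : v ≠ X.ctr)
    (x : V → ℝ) : x v - X.mean x = -(x X.ctr - X.mean x) := by
  obtain ⟨hvl, hc⟩ := h.resolve_left hv
  obtain ⟨l, hl⟩ := card_eq_one.1 hc
  have hvl : v = l := by simpa [hl] using hvl
  subst hvl
  have h1 := X.sum_leaves_sub x
  rw [hl, sum_singleton, card_verts, hc] at h1
  push_cast at h1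
  linarith

end Star

namespace HasTr

omit [DecidableRel G.Adj] in
theorem mean_mul_self (X : Star G) : HasTr (fun x => X.mean x ^ 2) (1 / X.verts.card) := by
  have := (HasTr.sum_mul_sum X.verts X.verts).const_mul (1 / (X.verts.card : ℝ) ^ 2)
  have h := X.cast_pos.ne'
  refine this.congr (fun x => ?_) ?_
  · unfold Star.mean
    field_simp
  · rw [inter_self]
    field_simp

omit [DecidableRel G.Adj] in
theorem mean_mul_mean {X Y : Star G} (h : Disjoint X.verts Y.verts) :
    HasTr (fun x => X.mean x * Y.mean x) 0 := by
  have := (HasTr.sum_mul_sum X.verts Y.verts).const_mul (1 / ((X.verts.card : ℝ) * Y.verts.card))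
  have h1 := X.cast_pos.ne'
  have h2 := Y.cast_pos.ne'
  refine this.congr (fun x => ?_) ?_
  · unfold Star.mean
    field_simp
  · rw [disjoint_iff_inter_eq_empty.1 h]
    simp

omit [DecidableRel G.Adj] in
theorem mean_mul_apply {X : Star G} {w : V} (h : w ∉ X.verts) :
    HasTr (fun x => X.mean x * x w) 0 := by
  have := (HasTr.sum_mul_sum X.verts {w}).const_mul (1 / (X.verts.card : ℝ))
  have h1 := X.cast_pos.ne'
  refine this.congr (fun x => ?_) ?_
  · unfold Star.mean
    simp only [sum_singleton]
    field_simp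
  · rw [inter_singleton_of_notMem h]
    simp

end HasTr

theorem Star.hasCert (X : Star G) : HasCert G X.verts 1 1 := by
  refine ⟨fun x => X.verts.card * X.mean x ^ 2, fun x => by positivity,
    ((HasTr.mean_mul_self X).const_mul _).congr (fun _ => rfl) ?_, fun x => ?_⟩
  · have := X.cast_pos.ne'
    field_simp
  · have := X.sum_sq_le x
    have : 0 ≤ (X.verts.card : ℝ) * (x X.ctr - X.mean x) ^ 2 := by positivity
    linarith

theorem Star.gainBound (X : Star G) : GainBound G X.verts 0 :=
  (X.hasCert.gainBound (by norm_num) X.hasMatching).mono (by norm_num)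

/-- A weighted Cauchy–Schwarz inequality. -/
theorem sq_add_add_le {a b : ℝ} (ha : 0 < a) (hb : 0 < b) (p q r : ℝ) :
    (p + q + r) ^ 2 / (1 + a + b) ≤ p ^ 2 + q ^ 2 / a + r ^ 2 / b := by
  rw [div_le_iff₀ (by positivity)]
  have h : (p ^ 2 + q ^ 2 / a + r ^ 2 / b) * (1 + a + b) - (p + q + r) ^ 2 =
      a * (p - q / a) ^ 2 + b * (p - r / b) ^ 2 + a * b * (q / a - r / b) ^ 2 := by
    field_simp
    ring
  have : 0 ≤ a * (p - q / a) ^ 2 + b * (p - r / b) ^ 2 + a * b * (q / a - r / b) ^ 2 := by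
    positivity
  linarith

theorem Star.hasCert_pair {X Y : Star G} (hd : Disjoint X.verts Y.verts)
    (hadj : G.Adj X.ctr Y.ctr) {σ : ℝ} (hσ : σ = 1 / X.verts.card + 1 / Y.verts.card) :
    HasCert G (X.verts ∪ Y.verts) 1 (2 - σ / (1 + σ)) := by
  have hX := X.cast_pos
  have hY := Y.cast_pos
  set M : ℝ := (X.verts.card : ℝ)
  set N : ℝ := (Y.verts.card : ℝ)
  have hσ0 : 0 < σ := by rw [hσ]; positivity
  have key : ∀ p c c' z z' : ℝ, p = (c - c') + z - z' →
      1 / (1 + σ) * (c - c') ^ 2 ≤ p ^ 2 + M * z ^ 2 + N * z' ^ 2 := by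
    intro p c c' z z' hp
    have h := sq_add_add_le (a := 1 / M) (b := 1 / N) (by positivity) (by positivity) p (-z) z'
    have e1 : p + -z + z' = c - c' := by rw [hp]; ring
    have e2 : 1 + 1 / M + 1 / N = 1 + σ := by rw [hσ]; ring
    rw [e1, e2] at h
    calc 1 / (1 + σ) * (c - c') ^ 2 = (c - c') ^ 2 / (1 + σ) := by ring
      _ ≤ _ := h
      _ = _ := by field_simp
  refine ⟨fun x => M * X.mean x ^ 2 + N * Y.mean x ^ 2 -
    1 / (1 + σ) * (X.mean x - Y.mean x) ^ 2, fun x => ?_, ?_, fun x => ?_⟩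
  · have := key 0 (X.mean x) (Y.mean x) (-X.mean x) (-Y.mean x) (by ring)
    linarith [this, neg_sq (X.mean x), neg_sq (Y.mean x)]
  · have h1 : HasTr _ (1 / M) := HasTr.mean_mul_self X
    have h2 : HasTr _ (1 / N) := HasTr.mean_mul_self Y
    have h3 := HasTr.mean_mul_mean hd
    refine ((((h1.const_mul M).add (h2.const_mul N)).sub
      (((h1.add h2).sub (h3.const_mul 2)).const_mul (1 / (1 + σ))))).congr
      (fun x => by ring) ?_
    rw [hσ]
    field_simp
    ring
  · have h1 := X.sum_sq_le x
    have h2 := Y.sum_sq_le x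
    have h3 := sq_sub_le_crossEnergy G X.ctr_mem Y.ctr_mem hadj x
    have h4 := key (x X.ctr - x Y.ctr) (X.mean x) (Y.mean x) (x X.ctr - X.mean x)
      (x Y.ctr - Y.mean x) (by ring)
    rw [energy_union G hd, sum_union hd]
    linarith

theorem Star.gainBound_pair {X Y : Star G} (hd : Disjoint X.verts Y.verts)
    (hadj : G.Adj X.ctr Y.ctr) {σ : ℝ} (hσ : σ = 1 / X.verts.card + 1 / Y.verts.card) :
    GainBound G (X.verts ∪ Y.verts) (σ / (1 + σ)) :=
  ((hasCert_pair hd hadj hσ).gainBound (by norm_num) (X.hasMatching.union Y.hasMatching hd)).mono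
    (by push_cast; linarith)

end Stars

section Bridges

open Finset Matrix

variable {V : Type} [Fintype V] [DecidableEq V] {G : SimpleGraph V} [DecidableRel G.Adj]

namespace Star

/-- The sum of squared deviations from the mean over the leaves. -/
noncomputable def leafVar (X : Star G) (x : V → ℝ) : ℝ :=
  ∑ l ∈ X.leaves, x l ^ 2 - (∑ l ∈ X.leaves, x l) ^ 2 / X.leaves.card

omit [DecidableRel G.Adj] in
theorem hasTr_leafVar (X : Star G) : HasTr X.leafVar (X.verts.card - 2) := by
  have h0 : (X.leaves.card : ℝ) ≠ 0 := by exact_mod_cast X.nonempty.card_pos.ne'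
  refine ((HasTr.sum_sq X.leaves).sub ((HasTr.sum_mul_sum X.leaves X.leaves).const_mul
    (1 / (X.leaves.card : ℝ)))).congr (fun x => ?_) ?_
  · unfold leafVar
    ring
  · rw [inter_self, card_verts]
    push_cast
    field_simp
    ring

omit [Fintype V] [DecidableEq V] [DecidableRel G.Adj] in
theorem leafVar_nonneg (X : Star G) (x : V → ℝ) : 0 ≤ X.leafVar x := by
  have h0 : (0 : ℝ) < X.leaves.card := by exact_mod_cast X.nonempty.card_pos
  unfold leafVar
  rw [sub_nonneg, div_le_iff₀ h0, mul_comm]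
  exact sq_sum_le_card_mul_sum_sq

omit [Fintype V] [DecidableRel G.Adj] in
theorem leafVar_eq (X : Star G) (x : V → ℝ) :
    X.leafVar x = ∑ l ∈ X.leaves, (x l - x X.ctr) ^ 2 -
      X.verts.card ^ 2 / (X.verts.card - 1) * (x X.ctr - X.mean x) ^ 2 := by
  have h0 : (X.leaves.card : ℝ) ≠ 0 := by exact_mod_cast X.nonempty.card_pos.ne'
  have h2 : (X.verts.card : ℝ) - 1 = X.leaves.card := by
    rw [card_verts]
    push_cast
    ring
  have h3 : ∀ l, x l ^ 2 = (x l - x X.ctr) ^ 2 + 2 * x X.ctr * (x l - x X.ctr) + x X.ctr ^ 2 :=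
    fun l => by ring
  have h4 : ∑ l ∈ X.leaves, x l =
      - X.verts.card * (x X.ctr - X.mean x) + X.leaves.card * x X.ctr := by
    have := X.sum_leaves_sub x
    rw [sum_sub_distrib, sum_const, nsmul_eq_mul] at this
    linarith
  unfold leafVar
  rw [h4, h2, sum_congr rfl (fun l _ => h3 l), sum_add_distrib, sum_add_distrib, ← mul_sum,
    X.sum_leaves_sub x, sum_const, nsmul_eq_mul]
  field_simp
  ring

/-- The parameters `θ, β, κ` are admissible for a star with `N` vertices attached to a vertex. -/
structure BridgeParams (N θ β κ : ℝ) : Prop where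
  θ_nonneg : 0 ≤ θ
  β_nonneg : 0 ≤ β
  amp_nonneg : 0 ≤ N - θ * N / (N - 1)
  amp : β * (1 + (N - θ * N / (N - 1))) ≤ N - θ * N / (N - 1)
  κ_pos : 0 < κ
  psd : β * (1 / ((1 + θ) * N) + 1 / κ) ≤ 1

omit [Fintype V] in
theorem bridge_le (X : Star G) {w : V} {θ β κ : ℝ}
    (h : BridgeParams X.verts.card θ β κ) (x : V → ℝ) :
    (1 + θ) * ∑ v ∈ X.verts, x v ^ 2 + β * (x w - X.mean x) ^ 2 ≤
      energy G X.verts x + (x w - x X.ctr) ^ 2 +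
      ((1 + θ) * X.verts.card * X.mean x ^ 2 + θ * X.leafVar x) := by
  have h1 := X.sum_le_energy x
  rw [X.leafVar_eq x, X.sum_sq_eq x]
  have hN : (X.verts.card : ℝ) - 1 ≠ 0 := by linarith [X.two_le_cast]
  set N : ℝ := (X.verts.card : ℝ)
  set z := x X.ctr - X.mean x with hz
  set u := x w - X.mean x with hu
  have e : x w - x X.ctr = u - z := by rw [hu, hz]; ring
  rw [e]
  have hA := h.amp
  have hA0 := h.amp_nonneg
  set A := N - θ * N / (N - 1) with hAd
  have h2 : β * u ^ 2 ≤ (u - z) ^ 2 + A * z ^ 2 := by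
    have h3 : (β * u ^ 2) * (1 + A) ≤ ((u - z) ^ 2 + A * z ^ 2) * (1 + A) := by
      have : (β * (1 + A)) * u ^ 2 ≤ A * u ^ 2 := mul_le_mul_of_nonneg_right hA (sq_nonneg _)
      nlinarith [sq_nonneg (u - (1 + A) * z)]
    exact le_of_mul_le_mul_right h3 (by linarith)
  have h4 : A = (1 + θ) * N - θ * (N ^ 2 / (N - 1)) := by
    rw [hAd]
    field_simp
    ring
  rw [h4] at h2
  nlinarith

omit [Fintype V] [DecidableRel G.Adj] in
theorem bridge_nonneg (X : Star G) {w : V} {θ β κ : ℝ}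
    (h : BridgeParams X.verts.card θ β κ) (x : V → ℝ) :
    0 ≤ (1 + θ) * X.verts.card * X.mean x ^ 2 + θ * X.leafVar x -
      β * (x w - X.mean x) ^ 2 + κ * x w ^ 2 := by
  have h1 := mul_nonneg h.θ_nonneg (X.leafVar_nonneg x)
  have hN := X.cast_pos
  have hθ := h.θ_nonneg
  have hκ := h.κ_pos
  have hp := h.psd
  set M : ℝ := (1 + θ) * (X.verts.card : ℝ) with hM
  have hM0 : 0 < M := by positivity
  set c := X.mean x
  set y := x w
  have h2 : (y - c) ^ 2 ≤ (1 / M + 1 / κ) * (M * c ^ 2 + κ * y ^ 2) := by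
    have : (1 / M + 1 / κ) * (M * c ^ 2 + κ * y ^ 2) - (y - c) ^ 2 =
        (M * c + κ * y) ^ 2 / (M * κ) := by
      field_simp
      ring
    have : 0 ≤ (M * c + κ * y) ^ 2 / (M * κ) := by positivity
    linarith
  have h3 : β * (y - c) ^ 2 ≤ 1 * (M * c ^ 2 + κ * y ^ 2) := by
    calc β * (y - c) ^ 2 ≤ β * ((1 / M + 1 / κ) * (M * c ^ 2 + κ * y ^ 2)) :=
          mul_le_mul_of_nonneg_left h2 h.β_nonneg
      _ = (β * (1 / M + 1 / κ)) * (M * c ^ 2 + κ * y ^ 2) := by ring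
      _ ≤ _ := mul_le_mul_of_nonneg_right hp (by positivity)
  linarith

/-- Two disjoint stars together with a vertex adjacent to both centres. -/
structure Bridge (X Y : Star G) (w : V) : Prop where
  disj : Disjoint X.verts Y.verts
  notMem_left : w ∉ X.verts
  notMem_right : w ∉ Y.verts
  adj_left : G.Adj w X.ctr
  adj_right : G.Adj w Y.ctr

namespace Bridge

variable {X Y : Star G} {w : V}

omit [Fintype V] [DecidableRel G.Adj] in
theorem symm (h : Bridge X Y w) : Bridge Y X w :=
  ⟨h.disj.symm, h.notMem_right, h.notMem_left, h.adj_right, h.adj_left⟩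

/-- The vertices of a bridge. -/
abbrev verts (_ : Bridge X Y w) : Finset V := X.verts ∪ Y.verts ∪ {w}

omit [Fintype V] [DecidableRel G.Adj] in
theorem disj_singleton (h : Bridge X Y w) : Disjoint (X.verts ∪ Y.verts) {w} := by
  simp [h.notMem_left, h.notMem_right]

omit [Fintype V] [DecidableRel G.Adj] in
theorem card_verts (h : Bridge X Y w) :
    h.verts.card = X.verts.card + Y.verts.card + 1 := by
  rw [verts, card_union_of_disjoint h.disj_singleton, card_union_of_disjoint h.disj]
  simp

omit [Fintype V] in
theorem le_energy (h : Bridge X Y w) (x : V → ℝ) :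
    energy G X.verts x + energy G Y.verts x + (x w - x X.ctr) ^ 2 + (x w - x Y.ctr) ^ 2 ≤
      energy G h.verts x := by
  rw [verts, energy_union G h.disj_singleton, energy_union G h.disj]
  have h1 := crossEnergy_nonneg G X.verts Y.verts x
  have h2 := energy_nonneg G {w} x
  have hne : X.ctr ≠ Y.ctr := fun e =>
    (Finset.disjoint_left.1 h.disj) X.ctr_mem (e ▸ Y.ctr_mem)
  have h3 := sum_le_crossEnergy G (S := X.verts ∪ Y.verts) (S' := {w}) (P := {X.ctr, Y.ctr})
    (fun _ => w) (by
      intro v hv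
      rcases mem_insert.1 hv with rfl | hv
      · exact mem_union_left _ X.ctr_mem
      · rw [mem_singleton.1 hv]
        exact mem_union_right _ Y.ctr_mem) (by simp [h.adj_left.symm, h.adj_right.symm]) x
  rw [sum_pair hne, sub_sq_comm (x X.ctr), sub_sq_comm (x Y.ctr)] at h3
  linarith

omit [Fintype V] [DecidableRel G.Adj] in
theorem hasMatching (h : Bridge X Y w) : HasMatching G h.verts 2 :=
  (X.hasMatching.union Y.hasMatching h.disj).mono subset_union_left

theorem hasCert (h : Bridge X Y w) {θ β κ β' κ' : ℝ}
    (hX : BridgeParams X.verts.card θ β κ) (hY : BridgeParams Y.verts.card θ β' κ')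
    (hκ : κ + κ' ≤ 1 + θ) :
    HasCert G h.verts (1 + θ)
      ((1 + θ) + θ * (X.verts.card - 2) - β * (1 + 1 / X.verts.card) +
       ((1 + θ) + θ * (Y.verts.card - 2) - β' * (1 + 1 / Y.verts.card)) + (1 + θ)) := by
  have htr : ∀ (X : Star G) (hw : w ∉ X.verts) (β : ℝ),
      HasTr (fun x => (1 + θ) * X.verts.card * X.mean x ^ 2 + θ * X.leafVar x -
        β * (x w - X.mean x) ^ 2)
      ((1 + θ) + θ * (X.verts.card - 2) - β * (1 + 1 / X.verts.card)) := by
    intro X hw β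
    have hN := X.cast_pos.ne'
    have h1 := HasTr.mean_mul_self X
    refine (((h1.const_mul ((1 + θ) * X.verts.card)).add (X.hasTr_leafVar.const_mul θ)).sub
      ((((HasTr.apply_mul_apply w w).add h1).sub
        ((HasTr.mean_mul_apply hw).const_mul 2)).const_mul β)).congr (fun x => by ring) ?_
    simp only [if_true]
    field_simp
    ring
  refine ⟨_, fun x => ?_, ((htr X h.notMem_left β).add (htr Y h.notMem_right β')).add
    (((HasTr.apply_mul_apply w w).const_mul (1 + θ)).congr (fun _ => rfl) (by simp)),
    fun x => ?_⟩
  · have h1 := X.bridge_nonneg (w := w) hX x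
    have h2 := Y.bridge_nonneg (w := w) hY x
    have h3 : (κ + κ') * x w ^ 2 ≤ (1 + θ) * x w ^ 2 :=
      mul_le_mul_of_nonneg_right hκ (sq_nonneg _)
    nlinarith
  · have h1 := X.bridge_le (w := w) hX x
    have h2 := Y.bridge_le (w := w) hY x
    have h3 := h.le_energy x
    rw [sum_union h.disj_singleton, sum_union h.disj, sum_singleton]
    nlinarith

theorem gainBound_of_params (h : Bridge X Y w) {θ β κ β' κ' : ℝ} (hθ : θ ≤ 1)
    (hX : BridgeParams X.verts.card θ β κ) (hY : BridgeParams Y.verts.card θ β' κ')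
    (hκ : κ + κ' ≤ 1 + θ) :
    GainBound G h.verts
      (β * (1 + 1 / X.verts.card) + β' * (1 + 1 / Y.verts.card) - 1) := by
  refine ((h.hasCert hX hY hκ).gainBound (by linarith) h.hasMatching).mono ?_
  rw [h.card_verts]
  push_cast
  apply le_of_eq
  ring

theorem gainBound_of_three_le (h : Bridge X Y w) (hX : 3 ≤ X.verts.card)
    (hY : 3 ≤ Y.verts.card) : GainBound G h.verts (2 / 3) := by
  have hp : ∀ X : Star G, 3 ≤ X.verts.card → BridgeParams X.verts.card (2 / 3)
      (5 / 6 * (X.verts.card / (X.verts.card + 1))) (5 / 6) := by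
    intro X hX
    have hN : (3 : ℝ) ≤ X.verts.card := by exact_mod_cast hX
    set N : ℝ := (X.verts.card : ℝ)
    have e : N - 2 / 3 * N / (N - 1) = N * (3 * N - 5) / (3 * (N - 1)) := by
      have : N - 1 ≠ 0 := by linarith
      field_simp
      ring
    have hN1 : 0 < N - 1 := by linarith
    refine ⟨by norm_num, by positivity, ?_, ?_, by norm_num, ?_⟩
    · rw [e]
      apply div_nonneg <;> nlinarith
    · rw [e, ← sub_nonneg]
      have : N * (3 * N - 5) / (3 * (N - 1)) - 5 / 6 * (N / (N + 1)) *
          (1 + N * (3 * N - 5) / (3 * (N - 1))) =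
          N * (3 * N ^ 2 - 2 * N - 15) / (18 * (N - 1) * (N + 1)) := by
        field_simp
        ring
      rw [this]
      apply div_nonneg <;> nlinarith
    · rw [← sub_nonneg]
      have : 1 - 5 / 6 * (N / (N + 1)) * (1 / ((1 + 2 / 3) * N) + 1 / (5 / 6)) =
          1 / (2 * (N + 1)) := by
        field_simp
        ring
      rw [this]
      positivity
  refine (h.gainBound_of_params (by norm_num) (hp X hX) (hp Y hY) (by norm_num)).mono ?_
  have h1 := X.cast_pos.ne'
  have h2 := Y.cast_pos.ne'
  apply le_of_eq
  field_simp
  ring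

theorem gainBound_of_four_le (h : Bridge X Y w) (hX : 4 ≤ X.verts.card)
    (hY : Y.verts.card = 2) : GainBound G h.verts (2 / 3) := by
  have hp : BridgeParams X.verts.card (6 / 11)
      (20 / 21 * (X.verts.card / (X.verts.card + 1))) (1632 / 1661) := by
    have hN : (4 : ℝ) ≤ X.verts.card := by exact_mod_cast hX
    set N : ℝ := (X.verts.card : ℝ)
    have hN1 : 0 < N - 1 := by linarith
    have e : N - 6 / 11 * N / (N - 1) = N * (11 * N - 17) / (11 * (N - 1)) := by
      field_simp
      ring
    refine ⟨by norm_num, by positivity, ?_, ?_, by norm_num, ?_⟩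
    · rw [e]
      apply div_nonneg <;> nlinarith
    · rw [e, ← sub_nonneg]
      have : N * (11 * N - 17) / (11 * (N - 1)) - 20 / 21 * (N / (N + 1)) *
          (1 + N * (11 * N - 17) / (11 * (N - 1))) =
          N * (11 * N ^ 2 - 6 * N - 137) / (231 * (N - 1) * (N + 1)) := by
        field_simp
        ring
      rw [this]
      apply div_nonneg <;> nlinarith
    · have : 20 / 21 * (N / (N + 1)) * (1 / ((1 + 6 / 11) * N) + 1 / (1632 / 1661)) =
          (20 / 21 * (11 / 17 + 1661 / 1632 * N)) / (N + 1) := by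
        field_simp
        ring
      rw [this, div_le_one (by linarith)]
      linarith
  have hp' : BridgeParams Y.verts.card (6 / 11) (10 / 21) (85 / 151) := by
    rw [hY]
    constructor <;> norm_num
  refine (h.gainBound_of_params (by norm_num) hp hp' (by norm_num)).mono ?_
  have h1 := X.cast_pos.ne'
  rw [hY]
  apply le_of_eq
  push_cast
  field_simp
  ring

end Bridge

end Star

end Bridges

section Trees

open Finset Matrix

variable {V : Type} [Fintype V] [DecidableEq V] {G : SimpleGraph V} [DecidableRel G.Adj]

omit [Fintype V] in
theorem tree_le_energy {n : ℕ} {v : Fin (n + 1) → V} (hv : Function.Injective v)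
    {par : Fin n → Fin (n + 1)} (hlt : ∀ i, par i < i.succ)
    (hadj : ∀ i, G.Adj (v i.succ) (v (par i))) (x : V → ℝ) :
    ∑ i : Fin n, (x (v i.succ) - x (v (par i))) ^ 2 ≤ energy G (univ.image v) x := by
  set f : Fin (n + 1) → Fin (n + 1) → ℝ := fun i j =>
    if G.Adj (v i) (v j) then (x (v i) - x (v j)) ^ 2 else 0 with hf
  have f0 : ∀ i j, 0 ≤ f i j := fun i j => by
    simp only [hf]
    split_ifs <;> positivity
  have fs : ∀ i j, f i j = f j i := fun i j => by
    simp only [hf, G.adj_comm (v i), sub_sq_comm (x (v i))]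
  have h1 : energy G (univ.image v) x = (∑ i, ∑ j, f i j) / 2 := by
    unfold energy
    rw [sum_image hv.injOn]
    simp_rw [sum_image hv.injOn]
    rfl
  set g : Fin (n + 1) → ℝ := fun i => ∑ j, if j < i then f i j else 0 with hg
  have h2 : ∑ i, g i + ∑ i, g i ≤ ∑ i, ∑ j, f i j := by
    have e : ∑ i, g i = ∑ i, ∑ j, if i < j then f i j else 0 := by
      rw [hg, sum_comm]
      exact sum_congr rfl fun i _ => sum_congr rfl fun j _ => by rw [fs]
    nth_rewrite 1 [e]
    rw [hg]
    rw [← sum_add_distrib]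
    refine sum_le_sum fun i _ => ?_
    rw [← sum_add_distrib]
    refine sum_le_sum fun j _ => ?_
    rcases lt_trichotomy i j with h | h | h
    · simp [h, h.not_gt]
    · simp [h, f0]
    · simp [h, h.not_gt]
  have g0 : ∀ i, 0 ≤ g i := fun i => sum_nonneg fun j _ => by
    split_ifs
    exacts [f0 i j, le_rfl]
  have h3 : ∑ i : Fin n, (x (v i.succ) - x (v (par i))) ^ 2 ≤ ∑ i, g i := by
    rw [Fin.sum_univ_succ]
    refine le_trans (sum_le_sum fun i _ => ?_) (le_add_of_nonneg_left (g0 0))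
    refine le_trans (le_of_eq ?_) (single_le_sum (f := fun j => if j < i.succ then f i.succ j else 0)
      (fun j _ => ?_) (mem_univ (par i)))
    · simp [hlt i, hf, hadj i]
    · split_ifs
      exacts [f0 _ _, le_rfl]
  rw [h1]
  linarith

theorem hasCert_of_tree {n r : ℕ} {v : Fin (n + 1) → V} (hv : (univ.image v).card = n + 1)
    {par : Fin n → Fin (n + 1)} (hlt : ∀ i, par i < i.succ)
    (hadj : ∀ i, G.Adj (v i.succ) (v (par i))) (d : Fin r → ℝ) (M : Fin r → Fin (n + 1) → ℝ)
    (hd : ∀ k, 0 ≤ d k) {s : ℝ} (h : ∀ y : Fin (n + 1) → ℝ, s * ∑ i, y i ^ 2 ≤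
      ∑ i : Fin n, (y i.succ - y (par i)) ^ 2 + ∑ k, d k * (∑ j, M k j * y j) ^ 2) :
    HasCert G (univ.image v) s (∑ k, d k * ∑ j, M k j ^ 2) := by
  have hv : Function.Injective v := by
    rw [← Set.injOn_univ, ← coe_univ]
    exact card_image_iff.1 (by simpa using hv)
  refine ⟨fun x => ∑ k, d k * (∑ j, M k j * x (v j)) ^ 2,
    fun x => sum_nonneg fun k _ => mul_nonneg (hd k) (sq_nonneg _), ?_, fun x => ?_⟩
  · refine HasTr.sum _ fun k _ => HasTr.const_mul _ ?_
    have := HasTr.sum univ fun i _ => HasTr.sum univ fun j _ =>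
      (HasTr.apply_mul_apply (v i) (v j)).const_mul (M k i * M k j)
    refine this.congr (fun x => ?_) ?_
    · rw [sq, sum_mul_sum]
      exact sum_congr rfl fun i _ => sum_congr rfl fun j _ => by ring
    · simp [hv.eq_iff, sq]
  · have h1 := tree_le_energy hv hlt hadj x
    have h2 := h fun i => x (v i)
    rw [sum_image hv.injOn]
    linarith

omit [Fintype V] [DecidableRel G.Adj] in
theorem hasMatching_of_pairs {n p : ℕ} {v : Fin (n + 1) → V} (hv : (univ.image v).card = n + 1)
    (a b : Fin p → Fin (n + 1)) (ha : Function.Injective a) (hb : Function.Injective b)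
    (hab : ∀ i j, a i ≠ b j) (hadj : ∀ i, G.Adj (v (a i)) (v (b i))) :
    HasMatching G (univ.image v) p := by
  have hv : Function.Injective v := by
    rw [← Set.injOn_univ, ← coe_univ]
    exact card_image_iff.1 (by simpa using hv)
  have hva : Function.Injective (v ∘ a) := hv.comp ha
  have hf : ∀ i, Function.extend (v ∘ a) (v ∘ b) id (v (a i)) = v (b i) := fun i =>
    hva.extend_apply (v ∘ b) id i
  refine ⟨univ.image (v ∘ a), Function.extend (v ∘ a) (v ∘ b) id, ?_, ?_, ?_, ?_⟩
  · intro u hu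
    obtain ⟨i, -, rfl⟩ := mem_image.1 hu
    exact mem_image_of_mem v (mem_univ _)
  · rw [card_image_of_injective _ hva, card_univ, Fintype.card_fin]
  · intro u hu u' hu' h
    obtain ⟨i, -, rfl⟩ := mem_image.1 (mem_coe.1 hu)
    obtain ⟨j, -, rfl⟩ := mem_image.1 (mem_coe.1 hu')
    simp only [Function.comp_apply, hf] at h
    rw [hb (hv h)]
  · intro u hu
    obtain ⟨i, -, rfl⟩ := mem_image.1 hu
    simp only [Function.comp_apply, hf]
    refine ⟨mem_sdiff.2 ⟨mem_image_of_mem v (mem_univ _), fun h => ?_⟩, hadj i⟩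
    obtain ⟨j, -, hj⟩ := mem_image.1 h
    exact hab j i (hv hj)

theorem hasCert_path_five {a b c d e : V} (hc : ({a, b, c, d, e} : Finset V).card = 5)
    (hab : G.Adj a b) (hbc : G.Adj b c) (hcd : G.Adj c d) (hde : G.Adj d e) :
    HasCert G {a, b, c, d, e} 1 (13 / 7) := by
  have him : univ.image ![a, b, c, d, e] = {a, b, c, d, e} := by
    ext
    simp [Fin.exists_fin_succ, eq_comm]
  rw [← him] at hc ⊢
  have := hasCert_of_tree (G := G) (s := 1) hc (par := ![0, 1, 2, 3]) (by decide)
    (by simp [Fin.forall_fin_succ, hab.symm, hbc.symm, hcd.symm, hde.symm])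
    ![1 / 5, 3 / 35] ![![1, 1, 1, 1, 1], ![-2, -1, 0, 1, 2]]
    (by simp [Fin.forall_fin_succ]; norm_num) (fun y => by
      simp only [Fin.sum_univ_succ]
      simp
      refine sub_nonneg.1 (le_of_le_of_eq (b := 19 / 35 * (y 0 - 22 / 19 * y 1 + 7 / 19 * y 2 +
        1 / 19 * y 3 - 5 / 19 * y 4) ^ 2 + 53 / 95 * (y 1 - 54 / 53 * y 2 + 14 / 53 * y 3 -
        13 / 53 * y 4) ^ 2 + 29 / 53 * (y 2 - 35 / 29 * y 3 + 6 / 29 * y 4) ^ 2 + 13 / 29 * (y 3 -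
        y 4) ^ 2) (by positivity) (by ring)))
  convert this using 1
  simp [Fin.sum_univ_succ]
  norm_num

theorem gainBound_path_five {a b c d e : V} (hc : ({a, b, c, d, e} : Finset V).card = 5) (hab :
  G.Adj a b) (hbc : G.Adj b c) (hcd : G.Adj c d) (hde : G.Adj d e) : GainBound G {a, b, c, d, e}
  (3 / 4) := by
  have him : univ.image ![a, b, c, d, e] = {a, b, c, d, e} := by
    ext
    simp [Fin.exists_fin_succ, eq_comm]
  rw [← him] at hc ⊢
  refine ((hasCert_of_tree (G := G) (s := 2) hc (par := ![0, 1, 2, 3]) (by decide)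
    (by simp [Fin.forall_fin_succ, hab.symm, hbc.symm, hcd.symm, hde.symm]) ![2 / 5, 1 / 16,
    1 / 58] ![![1, 1, 1, 1, 1], ![-3, -2, 0, 2, 3], ![-3, 1, 4, 1, -3]]
    (by simp [Fin.forall_fin_succ]; norm_num) (fun y => ?_)).gainBound (by norm_num)
    (hasMatching_of_pairs hc ![0, 3] ![1, 4] (by decide) (by decide) (by decide)
      (by simp [Fin.forall_fin_succ, hab, hde]))).mono ?_
  · simp only [Fin.sum_univ_succ]
    simp
    refine sub_nonneg.1 (le_of_le_of_eq (b := 273 / 2320 * (y 0 - 214 / 91 * y 1 + 64 / 39 * y 2 -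
      62 / 273 * y 3 - 17 / 273 * y 4) ^ 2 + 3 / 182 * (y 1 - 14 / 3 * y 2 + 19 / 3 * y 3 - 8 / 3
      * y 4) ^ 2) (by positivity) (by ring))
  · rw [hc]
    simp [Fin.sum_univ_succ]
    norm_num

theorem gainBound_forked_path_six {a b c d e f : V} (hc : ({a, b, c, d, e, f} : Finset V).card =
  6) (hab : G.Adj a b) (hbc : G.Adj b c) (hcd : G.Adj c d) (hde : G.Adj d e) (hdf : G.Adj d f) :
  GainBound G {a, b, c, d, e, f} (3 / 4) := by
  have him : univ.image ![a, b, c, d, e, f] = {a, b, c, d, e, f} := by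
    ext
    simp [Fin.exists_fin_succ, eq_comm]
  rw [← him] at hc ⊢
  refine ((hasCert_of_tree (G := G) (s := 16 / 11) hc (par := ![0, 1, 2, 3, 3]) (by decide)
    (by simp [Fin.forall_fin_succ, hab.symm, hbc.symm, hcd.symm, hde.symm, hdf.symm]) ![8 / 33,
    5 / 22, 17 / 3344] ![![1, 1, 1, 1, 1, 1], ![0, 0, 0, 0, 1, -1], ![-9, -7, -1, 5, 6, 6]]
    (by simp [Fin.forall_fin_succ]; norm_num) (fun y => ?_)).gainBound (by norm_num)
    (hasMatching_of_pairs hc ![0, 3] ![1, 4] (by decide) (by decide) (by decide)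
      (by simp [Fin.forall_fin_succ, hab, hde]))).mono ?_
  · simp only [Fin.sum_univ_succ]
    simp
    refine sub_nonneg.1 (le_of_le_of_eq (b := 2003 / 10032 * (y 0 - 4387 / 2003 * y 1 +
      2891 / 2003 * y 2 + 137 / 2003 * y 3 - 322 / 2003 * y 4 - 322 / 2003 * y 5) ^ 2 +
      1745 / 22033 * (y 1 - 2001 / 1745 * y 2 + 416 / 349 * y 3 - 912 / 1745 * y 4 - 912 / 1745 *
      y 5) ^ 2 + 5238 / 19195 * (y 2 - 6665 / 2619 * y 3 + 2023 / 2619 * y 4 + 2023 / 2619 * y 5)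
      ^ 2 + 986 / 28809 * (y 3 - 1 / 2 * y 4 - 1 / 2 * y 5) ^ 2) (by positivity) (by ring))
  · rw [hc]
    simp [Fin.sum_univ_succ]
    norm_num

theorem gainBound_path_seven {a b c d e f g : V} (hc : ({a, b, c, d, e, f, g} : Finset V).card =
  7) (hab : G.Adj a b) (hbc : G.Adj b c) (hcd : G.Adj c d) (hde : G.Adj d e) (hef : G.Adj e f)
  (hfg : G.Adj f g) : GainBound G {a, b, c, d, e, f, g} (6 / 7) := by
  have him : univ.image ![a, b, c, d, e, f, g] = {a, b, c, d, e, f, g} := by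
    ext
    simp [Fin.exists_fin_succ, eq_comm]
  rw [← him] at hc ⊢
  refine ((hasCert_of_tree (G := G) (s := 1) hc (par := ![0, 1, 2, 3, 4, 5]) (by decide)
    (by simp [Fin.forall_fin_succ, hab.symm, hbc.symm, hcd.symm, hde.symm, hef.symm, hfg.symm])
    ![1 / 7, 1 / 33, 1 / 48] ![![1, 1, 1, 1, 1, 1, 1], ![-3, -2, -1, 0, 1, 2, 3], ![2, 0, -1, -2,
    -1, 0, 2]] (by simp [Fin.forall_fin_succ]) (fun y => ?_)).gainBound (by norm_num)
    (hasMatching_of_pairs hc ![0, 2, 4] ![1, 3, 5] (by decide) (by decide) (by decide)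
      (by simp [Fin.forall_fin_succ, hab, hcd, hef]))).mono ?_
  · simp only [Fin.sum_univ_succ]
    simp
    refine sub_nonneg.1 (le_of_le_of_eq (b := 461 / 924 * (y 0 - 624 / 461 * y 1 + 355 / 922 * y 2
      + 55 / 461 * y 3 + 19 / 922 * y 4 - 36 / 461 * y 5 - 43 / 461 * y 6) ^ 2 + 484 / 1383 * (y 1
      - 371 / 242 * y 2 + 309 / 484 * y 3 + 133 / 484 * y 4 - 43 / 484 * y 5 - 141 / 484 * y 6) ^
      2 + 36 / 121 * (y 2 - 5 / 3 * y 3 + 67 / 72 * y 4 + 1 / 6 * y 5 - 31 / 72 * y 6) ^ 2 + 1 / 4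
      * (y 3 - 5 / 3 * y 4 + y 5 - 1 / 3 * y 6) ^ 2 + 31 / 144 * (y 4 - 60 / 31 * y 5 + 29 / 31 *
      y 6) ^ 2 + 6 / 31 * (y 5 - y 6) ^ 2) (by positivity) (by ring))
  · rw [hc]
    simp [Fin.sum_univ_succ]
    norm_num

theorem gainBound_branched_path_seven {a b c d e f g : V} (hc : ({a, b, c, d, e, f, g} : Finset
  V).card = 7) (hab : G.Adj a b) (hbc : G.Adj b c) (hcd : G.Adj c d) (hde : G.Adj d e) (hbf :
  G.Adj b f) (hfg : G.Adj f g) : GainBound G {a, b, c, d, e, f, g} (6 / 7) := by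
  have him : univ.image ![a, b, c, d, e, f, g] = {a, b, c, d, e, f, g} := by
    ext
    simp [Fin.exists_fin_succ, eq_comm]
  rw [← him] at hc ⊢
  refine ((hasCert_of_tree (G := G) (s := 4 / 3) hc (par := ![0, 1, 2, 3, 1, 5]) (by decide)
    (by simp [Fin.forall_fin_succ, hab.symm, hbc.symm, hcd.symm, hde.symm, hbf.symm, hfg.symm])
    ![4 / 21, 1 / 37, 1 / 18] ![![1, 1, 1, 1, 1, 1, 1], ![-1, -1, 1, 3, 4, -3, -3], ![-3, -1, 0,
    0, 1, 1, 2]] (by simp [Fin.forall_fin_succ]; norm_num) (fun y => ?_)).gainBound (by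
    norm_num)
    (hasMatching_of_pairs hc ![0, 3, 5] ![1, 4, 6] (by decide) (by decide) (by decide)
      (by simp [Fin.forall_fin_succ, hab, hde, hfg]))).mono ?_
  · simp only [Fin.sum_univ_succ]
    simp
    refine sub_nonneg.1 (le_of_le_of_eq (b := 199 / 518 * (y 0 - 319 / 199 * y 1 + 254 / 597 * y 2
      + 170 / 597 * y 3 - 131 / 597 * y 4 + 163 / 597 * y 5 - 32 / 199 * y 6) ^ 2 + 1706 / 1791 *
      (y 1 - 1029 / 1706 * y 2 + 255 / 853 * y 3 - 97 / 853 * y 4 - 1103 / 1706 * y 5 + 55 / 853 *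
      y 6) ^ 2 + 7187 / 15354 * (y 2 - 9262 / 7187 * y 3 + 4132 / 7187 * y 4 - 4709 / 7187 * y 5 +
      2652 / 7187 * y 6) ^ 2 + 4457 / 21561 * (y 3 - 1768 / 4457 * y 4 - 6334 / 4457 * y 5 +
      3645 / 4457 * y 6) ^ 2 + 1699 / 13371 * (y 4 - 876 / 1699 * y 5 - 823 / 1699 * y 6) ^ 2 +
      392 / 5097 * (y 5 - y 6) ^ 2) (by positivity) (by ring))
  · rw [hc]
    simp [Fin.sum_univ_succ]
    norm_num

theorem gainBound_spider_seven {a b c d e f g : V} (hc : ({a, b, c, d, e, f, g} : Finset V).card =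
  7) (hab : G.Adj a b) (hbc : G.Adj b c) (had : G.Adj a d) (hde : G.Adj d e) (haf : G.Adj a f)
  (hfg : G.Adj f g) : GainBound G {a, b, c, d, e, f, g} (1) := by
  have him : univ.image ![a, b, c, d, e, f, g] = {a, b, c, d, e, f, g} := by
    ext
    simp [Fin.exists_fin_succ, eq_comm]
  rw [← him] at hc ⊢
  refine ((hasCert_of_tree (G := G) (s := 3 / 2) hc (par := ![0, 1, 0, 3, 0, 5]) (by decide)
    (by simp [Fin.forall_fin_succ, hab.symm, hbc.symm, had.symm, hde.symm, haf.symm, hfg.symm])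
    ![3 / 14, 1 / 24, 5 / 16] ![![1, 1, 1, 1, 1, 1, 1], ![0, -1, -2, 2, 4, -1, -2], ![0, -1, -1,
    0, 0, 1, 1]] (by simp [Fin.forall_fin_succ]; norm_num) (fun y => ?_)).gainBound (by
    norm_num)
    (hasMatching_of_pairs hc ![1, 3, 5] ![2, 4, 6] (by decide) (by decide) (by decide)
      (by simp [Fin.forall_fin_succ, hbc, hde, hfg]))).mono ?_
  · simp only [Fin.sum_univ_succ]
    simp
    refine sub_nonneg.1 (le_of_le_of_eq (b := 12 / 7 * (y 0 - 11 / 24 * y 1 + 1 / 8 * y 2 -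
      11 / 24 * y 3 + 1 / 8 * y 4 - 11 / 24 * y 5 + 1 / 8 * y 6) ^ 2 + 17 / 24 * (y 1 - 7 / 17 * y
      2 - 11 / 34 * y 3 + 7 / 34 * y 4 - 10 / 17 * y 5 + 2 / 17 * y 6) ^ 2 + 19 / 408 * (y 2 +
      21 / 19 * y 3 - 35 / 19 * y 4 - 36 / 19 * y 5 + 31 / 19 * y 6) ^ 2 + 237 / 608 * (y 3 -
      43 / 79 * y 4 - 54 / 79 * y 5 + 18 / 79 * y 6) ^ 2 + 4 / 79 * (y 4 - 3 / 2 * y 5 + 1 / 2 * y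
      6) ^ 2) (by positivity) (by ring))
  · rw [hc]
    simp [Fin.sum_univ_succ]
    norm_num

theorem gainBound_corona_triangle_path {a b c d e f : V} (hc : ({a, b, c, d, e, f} : Finset
  V).card = 6) (hab : G.Adj a b) (hac : G.Adj a c) (hcd : G.Adj c d) (hae : G.Adj a e) (hef :
  G.Adj e f) : GainBound G {a, b, c, d, e, f} (1) := by
  have him : univ.image ![a, b, c, d, e, f] = {a, b, c, d, e, f} := by
    ext
    simp [Fin.exists_fin_succ, eq_comm]
  rw [← him] at hc ⊢
  refine ((hasCert_of_tree (G := G) (s := 2) hc (par := ![0, 0, 2, 0, 4]) (by decide)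
    (by simp [Fin.forall_fin_succ, hab.symm, hac.symm, hcd.symm, hae.symm, hef.symm]) ![1 / 3,
    1 / 6, 1 / 45] ![![1, 1, 1, 1, 1, 1], ![0, 0, 1, 2, -1, -2], ![-2, -6, 1, 3, 1, 3]]
    (by simp [Fin.forall_fin_succ]) (fun y => ?_)).gainBound (by norm_num)
    (hasMatching_of_pairs hc ![0, 2, 4] ![1, 3, 5] (by decide) (by decide) (by decide)
      (by simp [Fin.forall_fin_succ, hab, hcd, hef]))).mono ?_
  · simp only [Fin.sum_univ_succ]
    simp
    refine sub_nonneg.1 (le_of_le_of_eq (b := 64 / 45 * (y 0 - 9 / 32 * y 1 - 1 / 2 * y 2 + 9 / 64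
      * y 3 - 1 / 2 * y 4 + 9 / 64 * y 5) ^ 2 + 1 / 48 * (y 1 - 1 / 2 * y 3 - 1 / 2 * y 5) ^ 2 +
      1 / 6 * (y 2 - y 3 - y 4 + y 5) ^ 2) (by positivity) (by ring))
  · rw [hc]
    simp [Fin.sum_univ_succ]
    norm_num

end Trees

section Links

open Finset Matrix

variable {V : Type} [Fintype V] [DecidableEq V] {G : SimpleGraph V} [DecidableRel G.Adj]

namespace Star

omit [Fintype V] [DecidableEq V] [DecidableRel G.Adj] in
theorem card_leaves_eq_one [DecidableEq V] {X : Star G} (h : X.verts.card = 2) :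
    X.leaves.card = 1 := by
  rw [card_verts] at h
  omega

omit [Fintype V] [DecidableRel G.Adj] in
theorem exists_verts_eq_pair {X : Star G} (h : X.verts.card = 2) :
    ∃ l, G.Adj X.ctr l ∧ X.verts = {X.ctr, l} := by
  obtain ⟨l, hl⟩ := card_eq_one.1 (card_leaves_eq_one h)
  exact ⟨l, X.adj l (by simp [hl]), by rw [verts, hl]⟩

omit [Fintype V] [DecidableRel G.Adj] in
theorem exists_verts_eq_triple {X : Star G} (h : X.verts.card = 3) :
    ∃ l l', G.Adj X.ctr l ∧ G.Adj X.ctr l' ∧ X.verts = {X.ctr, l, l'} := by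
  rw [card_verts] at h
  obtain ⟨l, l', -, hl⟩ := card_eq_two.1 (by omega : X.leaves.card = 2)
  exact ⟨l, l', X.adj l (by simp [hl]), X.adj l' (by simp [hl]), by rw [verts, hl]⟩

/-- A star from which a leaf has been removed. -/
def eraseLeaf (X : Star G) (w : V) (h : 3 ≤ X.verts.card) : Star G where
  ctr := X.ctr
  leaves := X.leaves.erase w
  nonempty := by
    have := X.card_verts
    have := pred_card_le_card_erase (s := X.leaves) (a := w)
    exact card_pos.1 (by omega)
  ctr_notMem := fun h => X.ctr_notMem (mem_of_mem_erase h)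
  adj := fun l hl => X.adj l (mem_of_mem_erase hl)

omit [Fintype V] [DecidableRel G.Adj] in
theorem verts_eraseLeaf (X : Star G) {w : V} (h : 3 ≤ X.verts.card) (hw : w ∈ X.leaves) :
    (X.eraseLeaf w h).verts = X.verts.erase w := by
  have : w ≠ X.ctr := fun e => X.ctr_notMem (e ▸ hw)
  simp only [verts, eraseLeaf]
  rw [erase_insert_of_ne this.symm]

omit [Fintype V] [DecidableRel G.Adj] in
theorem three_le_card_of_not_isHub {X : Star G} {w : V} (hw : w ∈ X.verts) (h : ¬ X.IsHub w) :
    w ∈ X.leaves ∧ 3 ≤ X.verts.card := by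
  rcases mem_insert.1 hw with rfl | hw
  · exact absurd (Or.inl rfl) h
  · refine ⟨hw, ?_⟩
    by_contra hlt
    exact h (isHub_of_card_eq_two (X.leaves_subset hw) (by have := X.two_le_card; omega))

/-- Two stars joined by an edge at least one end of which is the centre of its star. -/
def HubLink (X Y : Star G) : Prop :=
  ∃ a ∈ X.verts, ∃ b ∈ Y.verts, G.Adj a b ∧ (X.IsHub a ∨ Y.IsHub b)

omit [Fintype V] [DecidableRel G.Adj] in
theorem exists_bridge_of_isHub {X Y : Star G} (hd : Disjoint X.verts Y.verts) {w b : V}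
    (hw : w ∈ X.verts) (hwX : ¬ X.IsHub w) (hb : Y.IsHub b) (hab : G.Adj w b) :
    ∃ A B : Star G, ∃ h : Bridge A B w, h.verts = X.verts ∪ Y.verts := by
  obtain ⟨hwl, h3⟩ := three_le_card_of_not_isHub hw hwX
  obtain ⟨B, rfl, hB⟩ := hb.exists_recenter
  have hA := X.verts_eraseLeaf h3 hwl
  refine ⟨X.eraseLeaf w h3, B, ⟨?_, ?_, ?_, (X.adj w hwl).symm, hab⟩, ?_⟩
  · rw [hA, hB]
    exact hd.mono_left (erase_subset _ _)
  · rw [hA]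
    simp
  · rw [hB]
    exact Finset.disjoint_left.1 hd hw
  · rw [Bridge.verts, hA, hB, union_right_comm, union_singleton, insert_erase hw]

omit [Fintype V] [DecidableRel G.Adj] in
theorem HubLink.isHub_or_exists_bridge {X Y : Star G} (h : HubLink X Y)
    (hd : Disjoint X.verts Y.verts) :
    (∃ a b, X.IsHub a ∧ Y.IsHub b ∧ G.Adj a b) ∨
      ∃ A B w, ∃ h : Bridge (G := G) A B w, h.verts = X.verts ∪ Y.verts := by
  obtain ⟨a, ha, b, hb, hab, h⟩ := h
  by_cases h1 : X.IsHub a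
  · by_cases h2 : Y.IsHub b
    · exact Or.inl ⟨a, b, h1, h2, hab⟩
    · obtain ⟨A, B, h, hh⟩ := exists_bridge_of_isHub hd.symm hb h2 h1 hab.symm
      exact Or.inr ⟨A, B, b, h, hh.trans (union_comm _ _)⟩
  · obtain ⟨A, B, h, hh⟩ := exists_bridge_of_isHub hd ha h1 (h.resolve_left h1) hab
    exact Or.inr ⟨A, B, a, h, hh⟩

namespace Bridge

variable {X Y : Star G} {w : V}

theorem gainBound_two_two (h : Bridge X Y w) (hX : X.verts.card = 2) (hY : Y.verts.card = 2) :
    GainBound G h.verts (3 / 4) := by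
  have hc := h.card_verts
  obtain ⟨l, hl, eX⟩ := exists_verts_eq_pair hX
  obtain ⟨m, hm, eY⟩ := exists_verts_eq_pair hY
  have e : h.verts = {l, X.ctr, w, Y.ctr, m} := by
    rw [Bridge.verts, eX, eY]
    ext
    simp
    tauto
  rw [e] at hc ⊢
  exact gainBound_path_five (by omega) hl.symm h.adj_left.symm h.adj_right hm

theorem hasCert_two_two (h : Bridge X Y w) (hX : X.verts.card = 2) (hY : Y.verts.card = 2) :
    HasCert G h.verts 1 (13 / 7) := by
  have hc := h.card_verts
  obtain ⟨l, hl, eX⟩ := exists_verts_eq_pair hX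
  obtain ⟨m, hm, eY⟩ := exists_verts_eq_pair hY
  have e : h.verts = {l, X.ctr, w, Y.ctr, m} := by
    rw [Bridge.verts, eX, eY]
    ext
    simp
    tauto
  rw [e] at hc ⊢
  exact hasCert_path_five (by omega) hl.symm h.adj_left.symm h.adj_right hm

theorem gainBound_two_three (h : Bridge X Y w) (hX : X.verts.card = 2) (hY : Y.verts.card = 3) :
    GainBound G h.verts (3 / 4) := by
  have hc := h.card_verts
  obtain ⟨l, hl, eX⟩ := exists_verts_eq_pair hX
  obtain ⟨m, m', hm, hm', eY⟩ := exists_verts_eq_triple hY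
  have e : h.verts = {l, X.ctr, w, Y.ctr, m, m'} := by
    rw [Bridge.verts, eX, eY]
    ext
    simp
    tauto
  rw [e] at hc ⊢
  exact gainBound_forked_path_six (by omega) hl.symm h.adj_left.symm h.adj_right hm hm'

omit [Fintype V] [DecidableRel G.Adj] in
theorem verts_symm (h : Bridge X Y w) : h.symm.verts = h.verts := by
  rw [Bridge.verts, Bridge.verts, union_comm Y.verts]

theorem gainBound_of_card_le_six (h : Bridge X Y w) (hc : h.verts.card ≤ 6) :
    GainBound G h.verts (3 / 4) := by
  rw [h.card_verts] at hc
  have hX := X.two_le_card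
  have hY := Y.two_le_card
  obtain ⟨h1, h2⟩ | ⟨h1, h2⟩ | ⟨h1, h2⟩ :
      (X.verts.card = 2 ∧ Y.verts.card = 2) ∨ (X.verts.card = 2 ∧ Y.verts.card = 3) ∨
      (X.verts.card = 3 ∧ Y.verts.card = 2) := by omega
  · exact h.gainBound_two_two h1 h2
  · exact h.gainBound_two_three h1 h2
  · rw [← h.verts_symm]
    exact h.symm.gainBound_two_three h2 h1

theorem gainBound (h : Bridge X Y w) : GainBound G h.verts (2 / 3) := by
  by_cases hc : h.verts.card ≤ 6
  · exact (h.gainBound_of_card_le_six hc).mono (by norm_num)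
  have hX := X.two_le_card
  have hY := Y.two_le_card
  rw [h.card_verts] at hc
  obtain ⟨h1, h2⟩ | ⟨h1, h2⟩ | ⟨h1, h2⟩ :
      (3 ≤ X.verts.card ∧ 3 ≤ Y.verts.card) ∨ (4 ≤ X.verts.card ∧ Y.verts.card = 2) ∨
      (4 ≤ Y.verts.card ∧ X.verts.card = 2) := by omega
  · exact h.gainBound_of_three_le h1 h2
  · exact h.gainBound_of_four_le h1 h2
  · rw [← h.verts_symm]
    exact h.symm.gainBound_of_four_le h1 h2

/-- A path on five vertices together with an edge attached to one of its vertices. -/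
theorem gainBound_union_of_adj (h : Bridge X Y w) (hX : X.verts.card = 2)
    (hY : Y.verts.card = 2) {Z : Star G} (hZ : Z.verts.card = 2)
    (hd : Disjoint h.verts Z.verts) {u v : V} (hu : u ∈ h.verts) (hv : v ∈ Z.verts)
    (huv : G.Adj u v) : GainBound G (h.verts ∪ Z.verts) (6 / 7) := by
  have hc : (h.verts ∪ Z.verts).card = 7 := by
    rw [card_union_of_disjoint hd, h.card_verts]
    omega
  obtain ⟨l, hl, eX⟩ := exists_verts_eq_pair hX
  obtain ⟨m, hm, eY⟩ := exists_verts_eq_pair hY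
  obtain ⟨Z', rfl, hZ'⟩ := (isHub_of_card_eq_two hv hZ).exists_recenter
  rw [← hZ'] at hZ hc ⊢
  obtain ⟨z, hz, eZ⟩ := exists_verts_eq_pair hZ
  have huw : u = w ∨ u = X.ctr ∨ u = l ∨ u = Y.ctr ∨ u = m := by
    rw [Bridge.verts, eX, eY] at hu
    simp at hu
    tauto
  rw [Bridge.verts, eX, eY, eZ] at hc ⊢
  have hXw := h.adj_left
  have hYw := h.adj_right
  rcases huw with rfl | rfl | rfl | rfl | rfl
  · have e : ({X.ctr, l} ∪ {Y.ctr, m} ∪ {u} ∪ {Z'.ctr, z} : Finset V) =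
        {u, X.ctr, l, Y.ctr, m, Z'.ctr, z} := by
      ext
      simp
      tauto
    rw [e] at hc ⊢
    exact (gainBound_spider_seven hc hXw hl hYw hm huv hz).mono (by norm_num)
  · have e : ({X.ctr, l} ∪ {Y.ctr, m} ∪ {w} ∪ {Z'.ctr, z} : Finset V) =
        {l, X.ctr, w, Y.ctr, m, Z'.ctr, z} := by
      ext
      simp
      tauto
    rw [e] at hc ⊢
    exact gainBound_branched_path_seven hc hl.symm hXw.symm hYw hm huv hz
  · have e : ({X.ctr, u} ∪ {Y.ctr, m} ∪ {w} ∪ {Z'.ctr, z} : Finset V) =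
        {z, Z'.ctr, u, X.ctr, w, Y.ctr, m} := by
      ext
      simp
      tauto
    rw [e] at hc ⊢
    exact gainBound_path_seven hc hz.symm huv.symm hl.symm hXw.symm hYw hm
  · have e : ({X.ctr, l} ∪ {Y.ctr, m} ∪ {w} ∪ {Z'.ctr, z} : Finset V) =
        {m, Y.ctr, w, X.ctr, l, Z'.ctr, z} := by
      ext
      simp
      tauto
    rw [e] at hc ⊢
    exact gainBound_branched_path_seven hc hm.symm hYw.symm hXw hl huv hz
  · have e : ({X.ctr, l} ∪ {Y.ctr, u} ∪ {w} ∪ {Z'.ctr, z} : Finset V) =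
        {z, Z'.ctr, u, Y.ctr, w, X.ctr, l} := by
      ext
      simp
      tauto
    rw [e] at hc ⊢
    exact gainBound_path_seven hc hz.symm huv.symm hm.symm hYw.symm hXw hl

end Bridge

theorem HubLink.gainBound {X Y : Star G} (h : HubLink X Y) (hd : Disjoint X.verts Y.verts) :
    GainBound G (X.verts ∪ Y.verts) (4 / ((X.verts.card + Y.verts.card : ℕ) + 4)) := by
  have h1 := X.two_le_cast
  have h2 := Y.two_le_cast
  push_cast
  rcases h.isHub_or_exists_bridge hd with ⟨a, b, ha, hb, hab⟩ | ⟨A, B, w, h, e⟩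
  · obtain ⟨X', rfl, hX'⟩ := ha.exists_recenter
    obtain ⟨Y', rfl, hY'⟩ := hb.exists_recenter
    rw [← hX', ← hY'] at hd ⊢
    rw [← hX'] at h1
    rw [← hY'] at h2
    refine (gainBound_pair hd hab rfl).mono ?_
    set M : ℝ := (X'.verts.card : ℝ)
    set N : ℝ := (Y'.verts.card : ℝ)
    rw [div_le_div_iff₀ (by positivity) (by positivity)]
    have : 4 / (M + N) ≤ 1 / M + 1 / N := by
      rw [div_add_div _ _ (by positivity) (by positivity), div_le_div_iff₀ (by positivity)
        (by positivity)]
      nlinarith [sq_nonneg (M - N)]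
    rw [div_le_iff₀ (by positivity)] at this
    nlinarith
  · rw [← e]
    refine h.gainBound.mono ?_
    rw [div_le_div_iff₀ (by positivity) (by positivity)]
    linarith

end Star

end Links

section Triples

open Finset Matrix

variable {V : Type} [Fintype V] [DecidableEq V] {G : SimpleGraph V} [DecidableRel G.Adj]

/-- The gain of a star with two pendant stars, in terms of the three sizes. -/
noncomputable def tripleGain (ε a b c : ℝ) : ℝ :=
  ((b + c * (b + 1)) * (a + c) + (a + c * (a + 1)) * (b + c) - 2 * ε * a * b) /
    (c * (2 * a * b + a + b + c * (a + 1) * (b + 1)))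

theorem le_tripleGain_of_polynomial {ε a b c : ℝ} (ha : 0 < a) (hb : 0 < b) (hc : 0 < c)
    (h : 0 ≤ ((b + c * (b + 1)) * (a + c) + (a + c * (a + 1)) * (b + c) - 2 * ε * a * b) *
      (a + b + c) - 6 * (c * (2 * a * b + a + b + c * (a + 1) * (b + 1)))) :
    6 / (c + a + b) ≤ tripleGain ε a b c := by
  rw [tripleGain, div_le_div_iff₀ (by positivity) (by positivity)]
  linarith

theorem le_tripleGain_neg {a b : ℝ} (ha : 2 ≤ a) (hb : 2 ≤ b) :
    6 / (2 + a + b) ≤ tripleGain (-1) a b 2 := by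
  obtain ⟨u, hu, rfl⟩ : ∃ u, 0 ≤ u ∧ a = 2 + u := ⟨a - 2, by linarith, by ring⟩
  obtain ⟨v, hv, rfl⟩ : ∃ v, 0 ≤ v ∧ b = 2 + v := ⟨b - 2, by linarith, by ring⟩
  apply le_tripleGain_of_polynomial (by positivity) (by positivity) (by positivity)
  ring_nf
  positivity

theorem le_tripleGain_left {a b c : ℝ} (ha : 3 ≤ a) (hb : 2 ≤ b) (hc : 2 ≤ c) :
    6 / (c + a + b) ≤ tripleGain 1 a b c := by
  obtain ⟨u, hu, rfl⟩ : ∃ u, 0 ≤ u ∧ a = 3 + u := ⟨a - 3, by linarith, by ring⟩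
  obtain ⟨v, hv, rfl⟩ : ∃ v, 0 ≤ v ∧ b = 2 + v := ⟨b - 2, by linarith, by ring⟩
  obtain ⟨w, hw, rfl⟩ : ∃ w, 0 ≤ w ∧ c = 2 + w := ⟨c - 2, by linarith, by ring⟩
  apply le_tripleGain_of_polynomial (by positivity) (by positivity) (by positivity)
  have h1 : 0 ≤ w ^ 2 * (u - v) ^ 2 := by positivity
  have h2 : 0 ≤ 12 + v * 32 + v * w * 16 + v * w * u * 4 + v * w * u ^ 2 * 2 + v * w ^ 2 * 2 +
      v * w ^ 3 + v * u * 16 + v * u ^ 2 * 4 + v ^ 2 * 20 + v ^ 2 * w * 12 + v ^ 2 * w * u * 2 +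
      v ^ 2 * u * 4 + w * 32 + w * u * 34 + w * u ^ 2 * 10 + w ^ 2 * 27 + w ^ 2 * u * 6 +
      w ^ 3 * 7 + w ^ 3 * u + u * 52 + u ^ 2 * 16 := by positivity
  linarith

theorem le_tripleGain_hub {a b c : ℝ} (ha : 2 ≤ a) (hb : 2 ≤ b) (hc : 3 ≤ c) :
    6 / (c + a + b) ≤ tripleGain 1 a b c := by
  obtain ⟨u, hu, rfl⟩ : ∃ u, 0 ≤ u ∧ a = 2 + u := ⟨a - 2, by linarith, by ring⟩
  obtain ⟨v, hv, rfl⟩ : ∃ v, 0 ≤ v ∧ b = 2 + v := ⟨b - 2, by linarith, by ring⟩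
  obtain ⟨w, hw, rfl⟩ : ∃ w, 0 ≤ w ∧ c = 3 + w := ⟨c - 3, by linarith, by ring⟩
  apply le_tripleGain_of_polynomial (by positivity) (by positivity) (by positivity)
  have h1 : 0 ≤ w ^ 2 * (u - v) ^ 2 + 2 * w * (u - v) ^ 2 := by positivity
  have h2 : 0 ≤ 12 + v * 39 + v * w * 25 + v * w * u ^ 2 * 2 + v * w ^ 2 * 7 + v * w ^ 3 +
      v * u * 6 + v * u ^ 2 * 6 + v ^ 2 * 27 + v ^ 2 * w * 10 + v ^ 2 * w * u * 2 +
      v ^ 2 * u * 6 + w * 70 + w * u * 25 + w * u ^ 2 * 10 + w ^ 2 * 40 + w ^ 2 * u * 7 +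
      w ^ 3 * 6 + w ^ 3 * u + u * 39 + u ^ 2 * 27 := by positivity
  linarith

theorem tripleGain_comm (ε a b c : ℝ) : tripleGain ε a b c = tripleGain ε b a c := by
  unfold tripleGain
  congr 1 <;> ring

theorem three_term_le {a b c β β' D ε : ℝ} (ha : 0 < a) (hb : 0 < b) (hc : 0 < c)
    (hβ : β = a / (a + 1)) (hβ' : β' = b / (b + 1)) (hD : D = β + β' + c) (hε : ε ^ 2 = 1)
    (z₀ z₁ z₂ δ₁ δ₂ : ℝ) :
    β * δ₁ ^ 2 + β' * δ₂ ^ 2 - (β * δ₁ + ε * β' * δ₂) ^ 2 / D ≤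
      (δ₁ + z₁ - z₀) ^ 2 + a * z₁ ^ 2 + ((δ₂ + z₂ - ε * z₀) ^ 2 + b * z₂ ^ 2) + c * z₀ ^ 2 := by
  have hβ0 : 0 < β := by rw [hβ]; positivity
  have hβ0' : 0 < β' := by rw [hβ']; positivity
  have hD0 : 0 < D := by rw [hD]; positivity
  have two : ∀ a β : ℝ, 0 < a → β = a / (a + 1) → ∀ p z : ℝ,
      β * p ^ 2 ≤ (p + z) ^ 2 + a * z ^ 2 := by
    intro a β ha hβ p z
    have : (p + z) ^ 2 + a * z ^ 2 - β * p ^ 2 = (p + (a + 1) * z) ^ 2 / (a + 1) := by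
      rw [hβ]
      field_simp
      ring
    have : 0 ≤ (p + (a + 1) * z) ^ 2 / (a + 1) := by positivity
    linarith
  have h1 := two a β ha hβ (δ₁ - z₀) z₁
  have h2 := two b β' hb hβ' (δ₂ - ε * z₀) z₂
  have h3 : β * (δ₁ - z₀) ^ 2 + β' * (δ₂ - ε * z₀) ^ 2 + c * z₀ ^ 2 -
      (β * δ₁ ^ 2 + β' * δ₂ ^ 2 - (β * δ₁ + ε * β' * δ₂) ^ 2 / D) =
      (D * z₀ - (β * δ₁ + ε * β' * δ₂)) ^ 2 / D := by
    field_simp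
    linear_combination (-(D * z₀ ^ 2)) * hD + D * β' * z₀ ^ 2 * hε
  have h4 : 0 ≤ (D * z₀ - (β * δ₁ + ε * β' * δ₂)) ^ 2 / D := by positivity
  have e1 : δ₁ - z₀ + z₁ = δ₁ + z₁ - z₀ := by ring
  have e2 : δ₂ - ε * z₀ + z₂ = δ₂ + z₂ - ε * z₀ := by ring
  rw [e1] at h1
  rw [e2] at h2
  linarith

namespace Star

theorem gainBound_triple {X Y Z : Star G} (hXY : Disjoint X.verts Y.verts)
    (hXZ : Disjoint X.verts Z.verts) (hYZ : Disjoint Y.verts Z.verts)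
    (hadj : G.Adj X.ctr Y.ctr) {a : V} (ha : a ∈ X.verts) (hadj' : G.Adj a Z.ctr) {ε : ℝ}
    (hε : ε = 1 ∨ ε = -1 ∧ X.verts.card = 2)
    (hz : ∀ x, x a - X.mean x = ε * (x X.ctr - X.mean x)) :
    GainBound G (X.verts ∪ Y.verts ∪ Z.verts)
      (tripleGain ε Y.verts.card Z.verts.card X.verts.card) := by
  have hX := X.cast_pos
  have hY := Y.cast_pos
  have hZ := Z.cast_pos
  have hd : Disjoint (X.verts ∪ Y.verts) Z.verts := disjoint_union_left.2 ⟨hXZ, hYZ⟩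
  have hεsq : ε ^ 2 = 1 := by rcases hε with rfl | ⟨rfl, -⟩ <;> norm_num
  have hε2 : ε = 1 ∨ ε = -1 ∧ (X.verts.card : ℝ) = 2 := by exact_mod_cast hε
  set A : ℝ := (Y.verts.card : ℝ) with hA
  set B : ℝ := (Z.verts.card : ℝ) with hB
  set C : ℝ := (X.verts.card : ℝ) with hC
  obtain ⟨β, hβ⟩ : ∃ β, β = A / (A + 1) := ⟨_, rfl⟩
  obtain ⟨β', hβ'⟩ : ∃ β', β' = B / (B + 1) := ⟨_, rfl⟩
  obtain ⟨D, hD⟩ : ∃ D, D = β + β' + C := ⟨_, rfl⟩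
  have hD0 : 0 < D := by
    have h1 : 0 < β := hβ ▸ div_pos hY (add_pos hY one_pos)
    have h2 : 0 < β' := hβ' ▸ div_pos hZ (add_pos hZ one_pos)
    exact hD ▸ add_pos (add_pos h1 h2) hX
  have key := three_term_le hY hZ hX hβ hβ' hD hεsq
  have hcert : HasCert G (X.verts ∪ Y.verts ∪ Z.verts) 1
      (3 - ((β - β ^ 2 / D) * (1 / A + 1 / C) + (β' - β' ^ 2 / D) * (1 / B + 1 / C) -
        2 * ε * (β * β' / D) * (1 / C))) := by
    refine ⟨fun x => C * X.mean x ^ 2 + A * Y.mean x ^ 2 + B * Z.mean x ^ 2 -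
      (β * (Y.mean x - X.mean x) ^ 2 + β' * (Z.mean x - X.mean x) ^ 2 -
        (β * (Y.mean x - X.mean x) + ε * β' * (Z.mean x - X.mean x)) ^ 2 / D),
      fun x => ?_, ?_, fun x => ?_⟩
    · rcases hε2 with rfl | ⟨rfl, hC2⟩
      · have := key (-X.mean x) (-Y.mean x) (-Z.mean x) (Y.mean x - X.mean x) (Z.mean x - X.mean x)
        nlinarith
      · have := key 0 (-Y.mean x) (-Z.mean x) (Y.mean x - X.mean x) (Z.mean x - X.mean x)
        rw [hC2]
        nlinarith
    · have hx : HasTr _ (1 / C) := HasTr.mean_mul_self X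
      have hy : HasTr _ (1 / A) := HasTr.mean_mul_self Y
      have hz : HasTr _ (1 / B) := HasTr.mean_mul_self Z
      have hxy := HasTr.mean_mul_mean hXY
      have hxz := HasTr.mean_mul_mean hXZ
      have hyz := HasTr.mean_mul_mean hYZ
      have h1 := (hy.add hx).sub (hxy.const_mul 2)
      have h2 := (hz.add hx).sub (hxz.const_mul 2)
      have h3 := (hyz.sub hxy).sub (hxz.sub hx)
      refine ((((hx.const_mul C).add (hy.const_mul A)).add (hz.const_mul B)).sub
        (((h1.const_mul (β - β ^ 2 / D)).add (h2.const_mul (β' - β' ^ 2 / D))).sub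
          (h3.const_mul (2 * ε * (β * β' / D))))).congr (fun x => ?_) ?_
      · linear_combination (β' ^ 2 / D * (Z.mean x - X.mean x) ^ 2) * hεsq
      · field_simp
        ring
    · have h1 := X.sum_sq_le x
      have h2 := Y.sum_sq_le x
      have h3 := Z.sum_sq_le x
      have h4 := sq_sub_le_crossEnergy G Y.ctr_mem X.ctr_mem hadj.symm x
      have h4' := sq_sub_le_crossEnergy G Z.ctr_mem (mem_union_left Y.verts ha) hadj'.symm x
      have h5 := key (x X.ctr - X.mean x) (x Y.ctr - Y.mean x) (x Z.ctr - Z.mean x)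
        (Y.mean x - X.mean x) (Z.mean x - X.mean x)
      rw [← hz] at h5
      have e1 : Y.mean x - X.mean x + (x Y.ctr - Y.mean x) - (x X.ctr - X.mean x) =
        x Y.ctr - x X.ctr := by ring
      have e2 : Z.mean x - X.mean x + (x Z.ctr - Z.mean x) - (x a - X.mean x) =
        x Z.ctr - x a := by ring
      rw [e1, e2] at h5
      rw [union_comm, energy_union G hd.symm, sum_union hd.symm, union_comm X.verts,
        energy_union G hXY.symm, sum_union hXY.symm]
      rw [union_comm X.verts] at h4'
      linarith
  refine (hcert.gainBound (by norm_num) ((X.hasMatching.union Y.hasMatching hXY).union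
    Z.hasMatching hd)).mono (le_of_eq ?_)
  have e : tripleGain ε A B C = (β - β ^ 2 / D) * (1 / A + 1 / C) +
      (β' - β' ^ 2 / D) * (1 / B + 1 / C) - 2 * ε * (β * β' / D) * (1 / C) := by
    have hD' : D = (2 * A * B + A + B + C * (A + 1) * (B + 1)) / ((A + 1) * (B + 1)) := by
      rw [hD, hβ, hβ']
      field_simp
      ring
    rw [hD', hβ, hβ', tripleGain]
    field_simp
    ring
  rw [e]
  push_cast
  ring

end Star

end Triples

section ThreeStars

open Finset

variable {V : Type} [Fintype V] [DecidableEq V] {G : SimpleGraph V} [DecidableRel G.Adj]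

namespace Star

theorem gainBound_triple_of_isHub {X Y Z : Star G} (hXY : Disjoint X.verts Y.verts)
    (hXZ : Disjoint X.verts Z.verts) (hYZ : Disjoint Y.verts Z.verts) {a a' b c : V}
    (ha : X.IsHub a) (ha' : X.IsHub a') (hb : Y.IsHub b) (hc : Z.IsHub c) (hab : G.Adj a b)
    (hac : G.Adj a' c) :
    GainBound G (X.verts ∪ Y.verts ∪ Z.verts)
      (6 / ((X.verts.card + Y.verts.card + Z.verts.card : ℕ) : ℝ)) := by
  obtain ⟨X, rfl, hX⟩ := ha.exists_recenter
  obtain ⟨Y, rfl, hY⟩ := hb.exists_recenter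
  obtain ⟨Z, rfl, hZ⟩ := hc.exists_recenter
  have hXa : X.IsHub a' := by
    rcases ha' with rfl | ⟨hl, h1⟩
    · by_cases h2 : X.verts.card = 2
      · exact isHub_of_card_eq_two (hX ▸ ctr_mem _) h2
      · rcases ha with h | ⟨-, h1⟩
        · exact Or.inl h.symm
        · rw [hX, card_verts, h1] at h2
          exact absurd rfl h2
    · exact isHub_of_card_eq_two (hX ▸ leaves_subset _ hl) (by rw [hX, card_verts, h1])
  rw [← hX, ← hY] at hXY
  rw [← hX, ← hZ] at hXZ
  rw [← hY, ← hZ] at hYZ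
  rw [← hX, ← hY, ← hZ]
  have hX2 := X.two_le_cast
  have hY2 := Y.two_le_cast
  have hZ2 := Z.two_le_cast
  push_cast
  by_cases hctr : a' = X.ctr
  · subst hctr
    have h := gainBound_triple hXY hXZ hYZ hab X.ctr_mem hac (Or.inl rfl) fun x => (one_mul _).symm
    by_cases h3 : 3 ≤ Y.verts.card
    · exact h.mono (le_tripleGain_left (by exact_mod_cast h3) hZ2 hX2)
    by_cases h4 : 3 ≤ Z.verts.card
    · rw [tripleGain_comm] at h
      refine h.mono ?_
      rw [add_right_comm]
      exact le_tripleGain_left (by exact_mod_cast h4) hY2 hX2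
    by_cases h5 : 3 ≤ X.verts.card
    · exact h.mono (le_tripleGain_hub hY2 hZ2 (by exact_mod_cast h5))
    have hX2' := X.two_le_card
    have hY2' := Y.two_le_card
    have hZ2' := Z.two_le_card
    have cX : X.verts.card = 2 := by omega
    have cY : Y.verts.card = 2 := by omega
    have cZ : Z.verts.card = 2 := by omega
    have hcard : (X.verts ∪ Y.verts ∪ Z.verts).card = 6 := by
      rw [card_union_of_disjoint (disjoint_union_left.2 ⟨hXZ, hYZ⟩), card_union_of_disjoint hXY]
      omega
    rw [cX, cY, cZ]
    obtain ⟨x, hx, eX⟩ := exists_verts_eq_pair cX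
    obtain ⟨y, hy, eY⟩ := exists_verts_eq_pair cY
    obtain ⟨z, hz, eZ⟩ := exists_verts_eq_pair cZ
    have e : X.verts ∪ Y.verts ∪ Z.verts = {X.ctr, x, Y.ctr, y, Z.ctr, z} := by
      rw [eX, eY, eZ]
      ext
      simp
      tauto
    rw [e] at hcard ⊢
    exact (gainBound_corona_triangle_path hcard hx hab hy hac hz).mono (by norm_num)
  · have cX : X.verts.card = 2 := by
      rw [card_verts, (hXa.resolve_left hctr).2]
    have h := gainBound_triple hXY hXZ hYZ hab hXa.mem hac (Or.inr ⟨rfl, cX⟩) fun x => by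
      rw [hXa.sub_mean_of_ne_ctr hctr, neg_one_mul]
    rw [cX] at h ⊢
    exact h.mono (by exact_mod_cast le_tripleGain_neg hY2 hZ2)

theorem Bridge.gainBound_union {A B Z : Star G} {w : V} (h : Bridge (G := G) A B w)
    (hd : Disjoint h.verts Z.verts) {u v : V} (hu : u ∈ h.verts) (hv : v ∈ Z.verts)
    (huv : G.Adj u v) :
    GainBound G (h.verts ∪ Z.verts) (6 / ((h.verts.card + Z.verts.card : ℕ) : ℝ)) := by
  have hA := A.two_le_card
  have hB := B.two_le_card
  have hZ := Z.two_le_card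
  have hc := h.card_verts
  by_cases h9 : 9 ≤ h.verts.card + Z.verts.card
  · have h9' : (9 : ℝ) ≤ ((h.verts.card + Z.verts.card : ℕ) : ℝ) := by exact_mod_cast h9
    refine (h.gainBound.union Z.gainBound hd).mono ?_
    rw [div_le_iff₀ (by linarith)]
    linarith
  by_cases h8 : h.verts.card + Z.verts.card = 8
  · refine ((h.gainBound_of_card_le_six (by omega)).union Z.gainBound hd).mono ?_
    rw [h8]
    norm_num
  · have h7 : h.verts.card + Z.verts.card = 7 := by omega
    rw [h7]
    exact h.gainBound_union_of_adj (by omega) (by omega) (by omega) hd hu hv huv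

theorem gainBound_triple_of_hubLink {X Y Z : Star G} (hXY : Disjoint X.verts Y.verts)
    (hXZ : Disjoint X.verts Z.verts) (hYZ : Disjoint Y.verts Z.verts) (hY : HubLink X Y)
    (hZ : HubLink X Z) :
    GainBound G (X.verts ∪ Y.verts ∪ Z.verts)
      (6 / ((X.verts.card + Y.verts.card + Z.verts.card : ℕ) : ℝ)) := by
  have aux : ∀ {Y Z : Star G}, Disjoint X.verts Y.verts → Disjoint X.verts Z.verts →
      Disjoint Y.verts Z.verts → HubLink X Z →
      (∃ A B w, ∃ h : Bridge (G := G) A B w, h.verts = X.verts ∪ Y.verts) →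
      GainBound G (X.verts ∪ Y.verts ∪ Z.verts)
        (6 / ((X.verts.card + Y.verts.card + Z.verts.card : ℕ) : ℝ)) := by
    rintro Y Z hXY hXZ hYZ ⟨u, hu, v, hv, huv, -⟩ ⟨A, B, w, h, e⟩
    rw [← card_union_of_disjoint hXY, ← e]
    exact h.gainBound_union (e ▸ disjoint_union_left.2 ⟨hXZ, hYZ⟩)
      (e ▸ mem_union_left _ hu) hv huv
  rcases hY.isHub_or_exists_bridge hXY with ⟨a, b, ha, hb, hab⟩ | h
  · rcases hZ.isHub_or_exists_bridge hXZ with ⟨a', c, ha', hc, hac⟩ | h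
    · exact gainBound_triple_of_isHub hXY hXZ hYZ ha ha' hb hc hab hac
    · have := aux hXZ hXY hYZ.symm hY h
      rwa [union_right_comm, add_right_comm] at this
  · exact aux hXY hXZ hYZ hZ h

end Star

end ThreeStars

section Families

open Finset

variable {V : Type} [Fintype V] [DecidableEq V] {G : SimpleGraph V} [DecidableRel G.Adj]
  {ι : Type} {s : Finset ι} {S : ι → Finset V}

theorem gainBound_empty : GainBound G ∅ 0 := by
  intro U _ I
  simp [energy, edgeCount]

omit [DecidableRel G.Adj] in
theorem hasMatching_empty : HasMatching G ∅ 0 := ⟨∅, id, by simp⟩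

theorem hasCert_empty (r : ℝ) : HasCert G ∅ r 0 :=
  ⟨fun _ => 0, fun _ => le_rfl, (hasTr_energy G ∅).congr (by simp [energy])
    (by simp [edgeCount]), fun x => by simp [energy]⟩

theorem GainBound.biUnion {g : ι → ℝ} (hd : (s : Set ι).PairwiseDisjoint S)
    (h : ∀ i ∈ s, GainBound G (S i) (g i)) : GainBound G (s.biUnion S) (∑ i ∈ s, g i) := by
  classical
  induction s using Finset.induction_on with
  | empty => simpa using gainBound_empty
  | insert i s hi ih =>
    rw [coe_insert, Set.pairwiseDisjoint_insert_of_notMem (by simpa using hi)] at hd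
    rw [biUnion_insert, sum_insert hi]
    exact (h i (mem_insert_self i s)).union (ih hd.1 fun j hj => h j (mem_insert_of_mem hj))
      (disjoint_biUnion_right _ _ _ |>.2 hd.2)

omit [DecidableRel G.Adj] in
theorem HasMatching.biUnion {p : ι → ℕ} (hd : (s : Set ι).PairwiseDisjoint S)
    (h : ∀ i ∈ s, HasMatching G (S i) (p i)) : HasMatching G (s.biUnion S) (∑ i ∈ s, p i) := by
  classical
  induction s using Finset.induction_on with
  | empty => simpa using hasMatching_empty
  | insert i s hi ih =>
    rw [coe_insert, Set.pairwiseDisjoint_insert_of_notMem (by simpa using hi)] at hd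
    rw [biUnion_insert, sum_insert hi]
    exact (h i (mem_insert_self i s)).union (ih hd.1 fun j hj => h j (mem_insert_of_mem hj))
      (disjoint_biUnion_right _ _ _ |>.2 hd.2)

theorem HasCert.biUnion {r : ℝ} {t : ι → ℝ} (hd : (s : Set ι).PairwiseDisjoint S)
    (h : ∀ i ∈ s, HasCert G (S i) r (t i)) : HasCert G (s.biUnion S) r (∑ i ∈ s, t i) := by
  classical
  induction s using Finset.induction_on with
  | empty => simpa using hasCert_empty r
  | insert i s hi ih =>
    rw [coe_insert, Set.pairwiseDisjoint_insert_of_notMem (by simpa using hi)] at hd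
    rw [biUnion_insert, sum_insert hi]
    exact (h i (mem_insert_self i s)).union (ih hd.1 fun j hj => h j (mem_insert_of_mem hj))
      (disjoint_biUnion_right _ _ _ |>.2 hd.2)

omit [Fintype V] in
theorem energy_add_sum_le_energy_biUnion {S₀ : Finset V} {a b : ι → V}
    (hd : (s : Set ι).PairwiseDisjoint S) (hd₀ : ∀ i ∈ s, Disjoint S₀ (S i))
    (ha : ∀ i ∈ s, a i ∈ S₀) (hb : ∀ i ∈ s, b i ∈ S i) (hab : ∀ i ∈ s, G.Adj (a i) (b i))
    (x : V → ℝ) :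
    energy G S₀ x + ∑ i ∈ s, (energy G (S i) x + (x (a i) - x (b i)) ^ 2) ≤
      energy G (S₀ ∪ s.biUnion S) x := by
  classical
  induction s using Finset.induction_on with
  | empty => simp
  | insert i s hi ih =>
    rw [coe_insert, Set.pairwiseDisjoint_insert_of_notMem (by simpa using hi)] at hd
    simp only [forall_mem_insert] at *
    have hdi : Disjoint (S₀ ∪ s.biUnion S) (S i) :=
      disjoint_union_left.2 ⟨hd₀.1, (disjoint_biUnion_left _ _ _).2 fun j hj => (hd.2 j hj).symm⟩
    have h1 := ih hd.1 hd₀.2 ha.2 hb.2 hab.2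
    have h2 := sq_sub_le_crossEnergy G (mem_union_left (s.biUnion S) ha.1) hb.1 hab.1 x
    rw [sum_insert hi, biUnion_insert, union_comm (S i), ← union_assoc, energy_union G hdi]
    linarith

theorem pendant_weight_le {a b d : ℝ} (ha : 0 < a) (ha' : a ≤ 1 / 2) (hb : 0 < b)
    (hb' : b ≤ 1 / 2) (hd : 3 ≤ d) :
    2 / (d + 1) * (a + b / d) ≤ 1 / (1 + a + d * b) * (a + b) := by
  have hd0 : 0 < d := by linarith
  have h1 : 0 ≤ a * (1 / 2 - a) * d := by
    have := sub_nonneg.2 ha'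
    positivity
  have h2 : 0 ≤ b * (1 / 2 - b) * d := by
    have := sub_nonneg.2 hb'
    positivity
  have h3 : 0 ≤ a * (1 / 2 - b) := mul_nonneg ha.le (sub_nonneg.2 hb')
  have h4 : 0 ≤ (d ^ 2 - 2) * (b * (1 / 2 - a)) :=
    mul_nonneg (by nlinarith) (mul_nonneg hb.le (sub_nonneg.2 ha'))
  have h5 : 0 ≤ (d - 3) * (d + 1) * a :=
    mul_nonneg (mul_nonneg (by linarith) (by linarith)) ha.le
  have e1 : 2 / (d + 1) * (a + b / d) = 2 * (d * a + b) / (d * (d + 1)) := by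
    field_simp
  have e2 : 1 / (1 + a + d * b) * (a + b) = (a + b) / (1 + a + d * b) := by
    field_simp
  rw [e1, e2, div_le_div_iff₀ (by positivity) (by positivity)]
  nlinarith

theorem sq_div_add_le {M N d : ℝ} (hM : 0 < M) (hN : 0 < N) :
    (d + 1) ^ 2 / (N + M) ≤ d ^ 2 / M + 1 / N := by
  rw [div_add_div _ _ hM.ne' hN.ne', div_le_div_iff₀ (by positivity) (by positivity)]
  nlinarith [sq_nonneg (d * N - M)]

namespace Star

/-- A hub with at least three pendant stars, all attached at their centres. -/
theorem gainBound_pendants {X : Star G} {Y : ι → Star G} {a : ι → V} (hs : 3 ≤ s.card)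
    (hd : (s : Set ι).PairwiseDisjoint fun i => (Y i).verts)
    (hd₀ : ∀ i ∈ s, Disjoint X.verts (Y i).verts) (ha : ∀ i ∈ s, X.IsHub (a i))
    (hab : ∀ i ∈ s, G.Adj (a i) (Y i).ctr) :
    GainBound G (X.verts ∪ s.biUnion fun i => (Y i).verts)
      (2 * (s.card + 1) / (X.verts.card + ∑ i ∈ s, (Y i).verts.card : ℕ)) := by
  have hX := X.cast_pos
  have hY : ∀ i, (0 : ℝ) < (Y i).verts.card := fun i => (Y i).cast_pos
  have hdX : Disjoint X.verts (s.biUnion fun i => (Y i).verts) :=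
    (disjoint_biUnion_right _ _ _).2 hd₀
  obtain ⟨d, hdef⟩ : ∃ d : ℝ, d = s.card := ⟨_, rfl⟩
  have hd3 : 3 ≤ d := by rw [hdef]; exact_mod_cast hs
  have hd0 : 0 < d := by linarith
  obtain ⟨w, hw⟩ : ∃ w : ι → ℝ, ∀ i, w i =
      1 / (1 + 1 / ((Y i).verts.card : ℝ) + d * (1 / (X.verts.card : ℝ))) := ⟨_, fun _ => rfl⟩
  have key : ∀ i, ∀ p c c₀ z r : ℝ, p = (c₀ - c) + r - z →
      w i * (c - c₀) ^ 2 ≤ p ^ 2 + (Y i).verts.card * z ^ 2 + X.verts.card * r ^ 2 / d := by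
    intro i p c c₀ z r hp
    have hYi := hY i
    have h := sq_add_add_le (a := 1 / ((Y i).verts.card : ℝ)) (b := d * (1 / X.verts.card))
      (by positivity) (by positivity) p z (-r)
    have e1 : p + z + -r = c₀ - c := by rw [hp]; ring
    rw [e1] at h
    calc w i * (c - c₀) ^ 2 = (c₀ - c) ^ 2 / _ := by rw [hw]; ring
      _ ≤ _ := h
      _ = _ := by field_simp
  have hsumX : ∀ c : ℝ, ∑ i ∈ s, X.verts.card * c / d = X.verts.card * c := by
    intro c
    rw [sum_const, nsmul_eq_mul, ← hdef]
    field_simp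
  have hcert : HasCert G (X.verts ∪ s.biUnion fun i => (Y i).verts) 1
      (1 + ∑ i ∈ s, (1 - w i * (1 / (Y i).verts.card + 1 / X.verts.card))) := by
    refine ⟨fun x => X.verts.card * X.mean x ^ 2 + ∑ i ∈ s, ((Y i).verts.card *
      (Y i).mean x ^ 2 - w i * ((Y i).mean x - X.mean x) ^ 2), fun x => ?_, ?_, fun x => ?_⟩
    · have h := sum_le_sum fun i (_ : i ∈ s) =>
        key i 0 ((Y i).mean x) (X.mean x) (-(Y i).mean x) (-X.mean x) (by ring)
      simp only [neg_sq, sum_add_distrib, hsumX] at h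
      simp only [sum_sub_distrib]
      simp only [sum_const_zero, ne_eq, OfNat.ofNat_ne_zero, not_false_eq_true, zero_pow] at h
      linarith
    · have h0 : HasTr _ (1 / X.verts.card) := HasTr.mean_mul_self X
      refine ((h0.const_mul X.verts.card).add (HasTr.sum s fun i hi =>
        (((HasTr.mean_mul_self (Y i)).const_mul (Y i).verts.card).sub
          ((((HasTr.mean_mul_self (Y i)).add h0).sub
            ((HasTr.mean_mul_mean (hd₀ i hi)).const_mul 2)).const_mul (w i))))).congr
        (fun x => ?_) ?_
      · exact congrArg₂ _ rfl (sum_congr rfl fun i _ => by ring)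
      · refine congrArg₂ _ (by field_simp) (sum_congr rfl fun i _ => ?_)
        have := hY i
        field_simp
        ring
    · have h1 := X.sum_sq_le x
      have h2 := energy_add_sum_le_energy_biUnion hd hd₀ (fun i hi => (ha i hi).mem)
        (fun i _ => (Y i).ctr_mem) hab x
      have h3 : ∑ i ∈ s, ∑ v ∈ (Y i).verts, x v ^ 2 +
          ∑ i ∈ s, (Y i).verts.card * (x (Y i).ctr - (Y i).mean x) ^ 2 ≤
          ∑ i ∈ s, energy G (Y i).verts x + ∑ i ∈ s, (Y i).verts.card * (Y i).mean x ^ 2 := by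
        rw [← sum_add_distrib, ← sum_add_distrib]
        exact sum_le_sum fun i _ => (Y i).sum_sq_le x
      have h4 := sum_le_sum fun i (_ : i ∈ s) =>
        key i (x (a i) - x (Y i).ctr) ((Y i).mean x) (X.mean x) (x (Y i).ctr - (Y i).mean x)
          (x (a i) - X.mean x) (by ring)
      have h5 : ∑ i ∈ s, X.verts.card * (x (a i) - X.mean x) ^ 2 / d =
          X.verts.card * (x X.ctr - X.mean x) ^ 2 := by
        rw [← hsumX]
        refine sum_congr rfl fun i hi => ?_
        by_cases h : a i = X.ctr
        · rw [h]
        · rw [(ha i hi).sub_mean_of_ne_ctr h, neg_sq]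
      rw [sum_add_distrib, sum_add_distrib, h5] at h4
      rw [sum_add_distrib] at h2
      rw [sum_union hdX, sum_biUnion hd]
      simp only [sum_sub_distrib]
      linarith
  have hmatch := X.hasMatching.union (HasMatching.biUnion hd fun i _ => (Y i).hasMatching) hdX
  refine (hcert.gainBound (by norm_num) hmatch).mono ?_
  have hgain : ∑ i ∈ s, 2 / (d + 1) * (1 / ((Y i).verts.card : ℝ) + 1 / X.verts.card / d) ≤
      ∑ i ∈ s, w i * (1 / (Y i).verts.card + 1 / X.verts.card) := by
    refine sum_le_sum fun i _ => ?_
    rw [hw]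
    have two : ∀ Z : Star G, (1 : ℝ) / Z.verts.card ≤ 1 / 2 := fun Z =>
      one_div_le_one_div_of_le two_pos Z.two_le_cast
    exact pendant_weight_le (by have := hY i; positivity) (two _) (by positivity) (two _) hd3
  have hM : 0 < ∑ i ∈ s, ((Y i).verts.card : ℝ) :=
    sum_pos (fun i _ => hY i) (card_pos.1 (by omega))
  have hcs : d ^ 2 / ∑ i ∈ s, ((Y i).verts.card : ℝ) ≤ ∑ i ∈ s, 1 / ((Y i).verts.card : ℝ) := by
    simpa [hdef] using sq_sum_div_le_sum_sq_div s (fun _ => (1 : ℝ)) fun i _ => hY i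
  have hsq := sq_div_add_le (d := d) hM hX
  rw [← mul_sum, sum_add_distrib, sum_const, nsmul_eq_mul, ← hdef] at hgain
  have e : d * (1 / (X.verts.card : ℝ) / d) = 1 / X.verts.card := by field_simp
  rw [e] at hgain
  have hfin : 2 * (d + 1) / ((X.verts.card : ℝ) + ∑ i ∈ s, ((Y i).verts.card : ℝ)) ≤
      2 / (d + 1) * (∑ i ∈ s, 1 / ((Y i).verts.card : ℝ) + 1 / X.verts.card) := by
    calc _ = 2 / (d + 1) * ((d + 1) ^ 2 / (X.verts.card + ∑ i ∈ s, ((Y i).verts.card : ℝ))) := by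
          field_simp
      _ ≤ _ := mul_le_mul_of_nonneg_left (by linarith) (by positivity)
  simp only [sum_sub_distrib, sum_const, nsmul_eq_mul, mul_one]
  push_cast
  rw [← hdef]
  linarith

end Star

end Families

section Clusters

open Finset

variable {V : Type} [Fintype V] [DecidableEq V] {G : SimpleGraph V} [DecidableRel G.Adj]
  {ι : Type} [DecidableEq ι] {s : Finset ι}

namespace Star

omit [DecidableEq ι] in
theorem gainBound_biUnion_zero {Y : ι → Star G}
    (hd : (s : Set ι).PairwiseDisjoint fun i => (Y i).verts) :
    GainBound G (s.biUnion fun i => (Y i).verts) 0 := by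
  simpa using GainBound.biUnion hd fun i _ => (Y i).gainBound

theorem gainBound_of_subset {X : Star G} {Y : ι → Star G} {J : Finset ι} (hJ : J ⊆ s)
    (hd : (s : Set ι).PairwiseDisjoint fun i => (Y i).verts)
    (hd₀ : ∀ i ∈ s, Disjoint X.verts (Y i).verts) {g : ℝ}
    (h : GainBound G (X.verts ∪ J.biUnion fun i => (Y i).verts) g) :
    GainBound G (X.verts ∪ s.biUnion fun i => (Y i).verts) g := by
  have h' := gainBound_biUnion_zero (Y := Y) (s := s \ J) (hd.subset (by simp))
  have e : X.verts ∪ (s.biUnion fun i => (Y i).verts) =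
      (X.verts ∪ J.biUnion fun i => (Y i).verts) ∪ (s \ J).biUnion fun i => (Y i).verts := by
    rw [union_assoc, ← union_biUnion, union_sdiff_of_subset hJ]
  rw [e, ← add_zero g]
  refine h.union h' ?_
  rw [disjoint_union_left, disjoint_biUnion_left, disjoint_biUnion_right]
  refine ⟨fun i hi => hd₀ i (sdiff_subset hi), fun i hi => ?_⟩
  rw [disjoint_biUnion_right]
  exact fun j hj => hd (hJ hi) (sdiff_subset hj) fun e => (mem_sdiff.1 hj).2 (e ▸ hi)

theorem gainBound_split {X : Star G} {Y : ι → Star G} {J : Finset ι} (hJ : J ⊆ s)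
    (hd : (s : Set ι).PairwiseDisjoint fun i => (Y i).verts)
    (hd₀ : ∀ i ∈ s, Disjoint X.verts (Y i).verts) {w : V} (hw : w ∈ X.leaves)
    (h3 : 3 ≤ X.verts.card) {g g' : ℝ}
    (h : GainBound G ({w} ∪ J.biUnion fun i => (Y i).verts) g)
    (h' : GainBound G ((X.eraseLeaf w h3).verts ∪ (s \ J).biUnion fun i => (Y i).verts) g') :
    GainBound G (X.verts ∪ s.biUnion fun i => (Y i).verts) (g + g') := by
  have hw' := X.leaves_subset hw
  rw [verts_eraseLeaf X h3 hw] at h'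
  have e : X.verts ∪ (s.biUnion fun i => (Y i).verts) =
      ({w} ∪ J.biUnion fun i => (Y i).verts) ∪
        (X.verts.erase w ∪ (s \ J).biUnion fun i => (Y i).verts) := by
    rw [union_union_union_comm, ← union_biUnion, union_sdiff_of_subset hJ, ← insert_eq,
      insert_erase hw']
  rw [e]
  refine h.union h' ?_
  refine disjoint_union_left.2 ⟨disjoint_union_right.2 ⟨by simp, ?_⟩,
    disjoint_union_right.2 ⟨?_, ?_⟩⟩
  · exact (disjoint_biUnion_right _ _ _).2 fun i hi =>
      disjoint_of_subset_left (singleton_subset_iff.2 hw') (hd₀ i (sdiff_subset hi))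
  · exact (disjoint_biUnion_left _ _ _).2 fun i hi =>
      disjoint_of_subset_right (erase_subset _ _) (hd₀ i (hJ hi)).symm
  · exact (disjoint_biUnion_left _ _ _).2 fun i hi => (disjoint_biUnion_right _ _ _).2 fun j hj =>
      hd (hJ hi) (sdiff_subset hj) fun e => (mem_sdiff.1 hj).2 (e ▸ hi)

omit [Fintype V] [DecidableRel G.Adj] [DecidableEq ι] in
theorem exists_verts_eq_pair_of_mem {Y : Star G} (h : Y.verts.card = 2) {b : V}
    (hb : b ∈ Y.verts) : ∃ e, G.Adj b e ∧ Y.verts = {b, e} := by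
  obtain ⟨Z, rfl, hZ⟩ := (isHub_of_card_eq_two hb h).exists_recenter
  rw [← hZ] at h ⊢
  exact exists_verts_eq_pair h

theorem gainBound_insert_one {Y : Star G} {w b : V} (hY : Y.verts.card = 2) (hb : b ∈ Y.verts)
    (hwb : G.Adj w b) : GainBound G ({w} ∪ Y.verts) 0 := by
  obtain ⟨e, hbe, eY⟩ := exists_verts_eq_pair_of_mem hY hb
  have hne : b ∉ ({w, e} : Finset V) := by
    simp [hwb.ne', hbe.ne]
  have := (Star.mk (G := G) b {w, e} (by simp) hne (by simp [hbe, hwb.symm])).gainBound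
  convert this using 1
  rw [eY]
  ext
  simp [verts]

theorem gainBound_insert_two {Y Z : Star G} {w b c : V} (hY : Y.verts.card = 2)
    (hZ : Z.verts.card = 2) (hd : Disjoint Y.verts Z.verts) (hwY : w ∉ Y.verts)
    (hwZ : w ∉ Z.verts) (hb : b ∈ Y.verts) (hc : c ∈ Z.verts) (hwb : G.Adj w b)
    (hwc : G.Adj w c) : GainBound G ({w} ∪ (Y.verts ∪ Z.verts)) (3 / 4) := by
  have hcard : ({w} ∪ (Y.verts ∪ Z.verts)).card = 5 := by
    rw [card_union_of_disjoint (by simp [hwY, hwZ]), card_union_of_disjoint hd, hY, hZ,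
      card_singleton]
  obtain ⟨e, hbe, eY⟩ := exists_verts_eq_pair_of_mem hY hb
  obtain ⟨f, hcf, eZ⟩ := exists_verts_eq_pair_of_mem hZ hc
  have e1 : {w} ∪ (Y.verts ∪ Z.verts) = {e, b, w, c, f} := by
    rw [eY, eZ]
    ext
    simp
    tauto
  rw [e1] at hcard ⊢
  exact gainBound_path_five hcard hbe.symm hwb.symm hwc hcf

theorem gainBound_insert_three {X Y Z : Star G} {w a b c : V} (hX : X.verts.card = 2)
    (hY : Y.verts.card = 2) (hZ : Z.verts.card = 2) (hXY : Disjoint X.verts Y.verts)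
    (hXZ : Disjoint X.verts Z.verts) (hYZ : Disjoint Y.verts Z.verts) (hwX : w ∉ X.verts)
    (hwY : w ∉ Y.verts) (hwZ : w ∉ Z.verts) (ha : a ∈ X.verts) (hb : b ∈ Y.verts)
    (hc : c ∈ Z.verts) (hwa : G.Adj w a) (hwb : G.Adj w b) (hwc : G.Adj w c) :
    GainBound G ({w} ∪ (X.verts ∪ (Y.verts ∪ Z.verts))) 1 := by
  have hcard : ({w} ∪ (X.verts ∪ (Y.verts ∪ Z.verts))).card = 7 := by
    rw [card_union_of_disjoint (by simp [hwX, hwY, hwZ]),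
      card_union_of_disjoint (disjoint_union_right.2 ⟨hXY, hXZ⟩), card_union_of_disjoint hYZ, hX,
      hY, hZ, card_singleton]
  obtain ⟨d, had, eX⟩ := exists_verts_eq_pair_of_mem hX ha
  obtain ⟨e, hbe, eY⟩ := exists_verts_eq_pair_of_mem hY hb
  obtain ⟨f, hcf, eZ⟩ := exists_verts_eq_pair_of_mem hZ hc
  have e1 : {w} ∪ (X.verts ∪ (Y.verts ∪ Z.verts)) = {w, a, d, b, e, c, f} := by
    rw [eX, eY, eZ]
    ext
    simp only [mem_union, mem_insert, mem_singleton, or_assoc]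
  rw [e1] at hcard ⊢
  exact gainBound_spider_seven hcard hwa had hwb hbe hwc hcf

/-- The gain obtained from a star all of whose pendant stars are linked to it through a hub. -/
def ClusterBound (X : Star G) (Y : ι → Star G) (s : Finset ι) : Prop :=
  GainBound G (X.verts ∪ s.biUnion fun i => (Y i).verts)
    (2 * (s.card + 1) / (X.verts.card + ∑ i ∈ s, (Y i).verts.card : ℕ))

theorem clusterBound_of_isHub {X : Star G} {Y : ι → Star G} (hs : 3 ≤ s.card)
    (hd : (s : Set ι).PairwiseDisjoint fun i => (Y i).verts)
    (hd₀ : ∀ i ∈ s, Disjoint X.verts (Y i).verts)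
    (h : ∀ i ∈ s, ∃ a b, X.IsHub a ∧ (Y i).IsHub b ∧ G.Adj a b) : ClusterBound X Y s := by
  have h' : ∀ i, ∃ (a : V) (Y' : Star G), Y'.verts = (Y i).verts ∧
      (i ∈ s → X.IsHub a ∧ G.Adj a Y'.ctr) := by
    intro i
    by_cases hi : i ∈ s
    · obtain ⟨a, b, ha, hb, hab⟩ := h i hi
      obtain ⟨Y', rfl, hY'⟩ := hb.exists_recenter
      exact ⟨a, Y', hY', fun _ => ⟨ha, hab⟩⟩
    · exact ⟨X.ctr, Y i, rfl, fun h => absurd h hi⟩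
  choose a Y' hY' h' using h'
  have := gainBound_pendants (X := X) (Y := Y') (a := a) hs (by simpa only [hY'] using hd)
    (by simpa only [hY'] using hd₀) (fun i hi => (h' i hi).1) fun i hi => (h' i hi).2
  simpa only [ClusterBound, hY'] using this

theorem clusterBound_of_card_eq_two {X : Star G} {Y : ι → Star G} (hs : s.card = 2)
    (hd : (s : Set ι).PairwiseDisjoint fun i => (Y i).verts)
    (hd₀ : ∀ i ∈ s, Disjoint X.verts (Y i).verts) (h : ∀ i ∈ s, HubLink X (Y i)) :
    ClusterBound X Y s := by
  obtain ⟨i, j, hij, rfl⟩ := card_eq_two.1 hs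
  have := gainBound_triple_of_hubLink (hd₀ i (by simp)) (hd₀ j (by simp))
    (hd (by simp) (by simp) hij) (h i (by simp)) (h j (by simp))
  rw [ClusterBound, hs, sum_pair hij, ← add_assoc]
  simp only [biUnion_insert, singleton_biUnion, ← union_assoc]
  exact this.mono (by norm_num)

end Star

end Clusters

section Clusters

open Finset

variable {V : Type} [Fintype V] [DecidableEq V] {G : SimpleGraph V} [DecidableRel G.Adj]
  {ι : Type} [DecidableEq ι]

namespace Star

theorem ClusterBound.of_subset {X : Star G} {Y : ι → Star G} {s J : Finset ι} (hJ : J ⊆ s)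
    (hd : (s : Set ι).PairwiseDisjoint fun i => (Y i).verts)
    (hd₀ : ∀ i ∈ s, Disjoint X.verts (Y i).verts) {g : ℝ}
    (h : GainBound G (X.verts ∪ J.biUnion fun i => (Y i).verts) g)
    (hg : 2 * (s.card + 1) ≤ g * (X.verts.card + ∑ i ∈ s, (Y i).verts.card : ℕ)) :
    ClusterBound X Y s := by
  refine (gainBound_of_subset hJ hd hd₀ h).mono ?_
  have := X.two_le_card
  exact (div_le_iff₀ (Nat.cast_pos.2 (by omega))).2 hg

/-- The inductive step when some pendant star is attached at the leaf `w` of `X`. -/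
theorem clusterBound_of_leaf {X : Star G} {Y : ι → Star G} {s : Finset ι} (hs : 3 ≤ s.card)
    (ih : ∀ (X' : Star G) (t : Finset ι), t.card < s.card → 2 ≤ t.card →
      (t : Set ι).PairwiseDisjoint (fun i => (Y i).verts) →
      (∀ i ∈ t, Disjoint X'.verts (Y i).verts) → (∀ i ∈ t, HubLink X' (Y i)) →
      ClusterBound X' Y t)
    (hd : (s : Set ι).PairwiseDisjoint fun i => (Y i).verts)
    (hd₀ : ∀ i ∈ s, Disjoint X.verts (Y i).verts) (h2 : ∀ i ∈ s, (Y i).verts.card = 2)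
    {a b : ι → V} (ha : ∀ i ∈ s, a i ∈ X.verts) (hb : ∀ i ∈ s, b i ∈ (Y i).verts)
    (hab : ∀ i ∈ s, G.Adj (a i) (b i)) {w : V} (hw : w ∈ X.leaves) (h3 : 3 ≤ X.verts.card)
    (hX : X.verts.card < s.card + 3) (hJ : (s.filter (a · = w)).Nonempty) :
    ClusterBound X Y s := by
  obtain ⟨m, hm⟩ : ∃ m, m = s.card := ⟨_, rfl⟩
  obtain ⟨x, hx⟩ : ∃ x, x = X.verts.card := ⟨_, rfl⟩
  have hm3 : (3 : ℝ) ≤ m := by exact_mod_cast hm ▸ hs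
  have hx3 : (3 : ℝ) ≤ x := by exact_mod_cast hx ▸ h3
  have hxm : (x : ℝ) + 1 ≤ m + 3 := by exact_mod_cast (by omega : x + 1 ≤ m + 3)
  have hw' := X.leaves_subset hw
  have hwY : ∀ i ∈ s, w ∉ (Y i).verts := fun i hi => disjoint_left.1 (hd₀ i hi) hw'
  have hX' := verts_eraseLeaf X h3 hw
  have hX'card : (X.eraseLeaf w h3).verts.card = x - 1 := by
    rw [hX', card_erase_of_mem hw', hx]
  have hX'sub : (X.eraseLeaf w h3).verts ⊆ X.verts := hX' ▸ erase_subset _ _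
  have hd' : ∀ {J : Finset ι}, ((s \ J : Finset ι) : Set ι).PairwiseDisjoint
      fun i => (Y i).verts := fun {J} => hd.subset (by simp)
  have hd₀' : ∀ i ∈ s, Disjoint (X.eraseLeaf w h3).verts (Y i).verts :=
    fun i hi => disjoint_of_subset_left hX'sub (hd₀ i hi)
  have hlink : ∀ i ∈ s, a i ≠ w → HubLink (X.eraseLeaf w h3) (Y i) := fun i hi hne =>
    ⟨a i, by rw [hX']; exact mem_erase.2 ⟨hne, ha i hi⟩, b i, hb i hi, hab i hi,
      Or.inr (isHub_of_card_eq_two (hb i hi) (h2 i hi))⟩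
  have hsum : ∀ t ⊆ s, ∑ i ∈ t, (Y i).verts.card = 2 * t.card := fun t ht => by
    rw [sum_congr rfl fun i hi => h2 i (ht hi), sum_const, smul_eq_mul, mul_comm]
  have main : ∀ {J : Finset ι} {g g' : ℝ}, J ⊆ s →
      GainBound G ({w} ∪ J.biUnion fun i => (Y i).verts) g →
      GainBound G ((X.eraseLeaf w h3).verts ∪ (s \ J).biUnion fun i => (Y i).verts) g' →
      2 * (m + 1) ≤ (g + g') * (x + 2 * m) → ClusterBound X Y s := by
    intro J g g' hJs h h' hg
    refine (gainBound_split hJs hd hd₀ hw h3 h h').mono ?_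
    rw [hsum s subset_rfl, ← hx, ← hm, div_le_iff₀ (Nat.cast_pos.2 (by omega))]
    push_cast
    exact hg
  have hmemJ : ∀ i ∈ s.filter (a · = w), i ∈ s ∧ G.Adj w (b i) := fun i hi => by
    obtain ⟨his, hi⟩ := mem_filter.1 hi
    exact ⟨his, hi ▸ hab i his⟩
  obtain h1 | h2' | h3' : (s.filter (a · = w)).card = 1 ∨ (s.filter (a · = w)).card = 2 ∨
      3 ≤ (s.filter (a · = w)).card := by
    have := hJ.card_pos
    omega
  · obtain ⟨i, hi⟩ := card_eq_one.1 h1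
    obtain ⟨his, hadj⟩ := hmemJ i (by simp [hi])
    have hcard : (s \ {i}).card = m - 1 := by
      rw [card_sdiff_of_subset (singleton_subset_iff.2 his), card_singleton, hm]
    have hih := ih (X.eraseLeaf w h3) (s \ {i}) (by omega) (by omega) hd'
      (fun j hj => hd₀' j (sdiff_subset hj)) fun j hj => by
        obtain ⟨hjs, hji⟩ := mem_sdiff.1 hj
        exact hlink j hjs fun e => hji (hi ▸ mem_filter.2 ⟨hjs, e⟩)
    refine main (J := {i}) (singleton_subset_iff.2 his)
      (by simpa using gainBound_insert_one (h2 i his) (hb i his) hadj) hih ?_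
    rw [hsum _ sdiff_subset, hX'card, hcard]
    push_cast [Nat.cast_sub (by omega : 1 ≤ m), Nat.cast_sub (by omega : 1 ≤ x)]
    rw [zero_add, div_mul_eq_mul_div, le_div_iff₀ (by linarith)]
    nlinarith
  · obtain ⟨i, j, hij, hi⟩ := card_eq_two.1 h2'
    obtain ⟨his, hadj⟩ := hmemJ i (by simp [hi])
    obtain ⟨hjs, hadj'⟩ := hmemJ j (by simp [hi])
    have hsub : {i, j} ⊆ s := by simp [insert_subset_iff, his, hjs]
    have hcard : (s \ {i, j}).card = m - 2 := by
      rw [card_sdiff_of_subset hsub, card_pair hij, hm]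
    have hp := gainBound_insert_two (h2 i his) (h2 j hjs) (hd his hjs hij) (hwY i his)
      (hwY j hjs) (hb i his) (hb j hjs) hadj hadj'
    have hlink' : ∀ l ∈ s \ {i, j}, HubLink (X.eraseLeaf w h3) (Y l) := fun l hl => by
      obtain ⟨hls, hli⟩ := mem_sdiff.1 hl
      exact hlink l hls fun e => hli (hi ▸ mem_filter.2 ⟨hls, e⟩)
    by_cases hm4 : 4 ≤ m
    · have hih := ih (X.eraseLeaf w h3) (s \ {i, j}) (by omega) (by omega) hd'
        (fun j hj => hd₀' j (sdiff_subset hj)) hlink'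
      refine main (J := {i, j}) hsub (by simpa using hp) hih ?_
      rw [hsum _ sdiff_subset, hX'card, hcard]
      have hm4' : (4 : ℝ) ≤ m := by exact_mod_cast hm4
      push_cast [Nat.cast_sub (by omega : 2 ≤ m), Nat.cast_sub (by omega : 1 ≤ x)]
      have hpos : (0 : ℝ) < x - 1 + 2 * (m - 2) := by linarith
      rw [div_add_div _ _ (by norm_num) hpos.ne', div_mul_eq_mul_div,
        le_div_iff₀ (by positivity)]
      nlinarith
    · obtain ⟨l, hl⟩ := card_eq_one.1 (by omega : (s \ {i, j}).card = 1)
      have hls : l ∈ s \ {i, j} := by simp [hl]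
      have hih := (hlink' l hls).gainBound (hd₀' l (sdiff_subset hls))
      refine main (J := {i, j}) hsub (by simpa using hp) (by simpa [hl] using hih) ?_
      rw [h2 l (sdiff_subset hls), hX'card]
      have hm3' : (m : ℝ) = 3 := by exact_mod_cast (by omega : m = 3)
      push_cast [Nat.cast_sub (by omega : 1 ≤ x)]
      rw [hm3', div_add_div _ _ (by norm_num) (by linarith), div_mul_eq_mul_div,
        le_div_iff₀ (by linarith)]
      nlinarith
  · obtain ⟨i, hi, j, hj, l, hl, hij, hil, hjl⟩ := two_lt_card.1 h3'
    obtain ⟨his, hadj⟩ := hmemJ i hi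
    obtain ⟨hjs, hadj'⟩ := hmemJ j hj
    obtain ⟨hls, hadj''⟩ := hmemJ l hl
    have hp := gainBound_insert_three (h2 i his) (h2 j hjs) (h2 l hls) (hd his hjs hij)
      (hd his hls hil) (hd hjs hls hjl) (hwY i his) (hwY j hjs) (hwY l hls) (hb i his) (hb j hjs)
      (hb l hls) hadj hadj' hadj''
    refine main (J := {i, j, l}) (by simp [insert_subset_iff, his, hjs, hls]) (by simpa using hp)
      ((X.eraseLeaf w h3).gainBound.union (gainBound_biUnion_zero hd') ?_) (by linarith)
    exact (disjoint_biUnion_right _ _ _).2 fun j hj => hd₀' j (sdiff_subset hj)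

theorem clusterBound {Y : ι → Star G} {X : Star G} {s : Finset ι} (hs : 2 ≤ s.card)
    (hd : (s : Set ι).PairwiseDisjoint fun i => (Y i).verts)
    (hd₀ : ∀ i ∈ s, Disjoint X.verts (Y i).verts) (h : ∀ i ∈ s, HubLink X (Y i)) :
    ClusterBound X Y s := by
  induction hm : s.card using Nat.strong_induction_on generalizing X s with
  | _ m IH =>
  have ih : ∀ (X' : Star G) (t : Finset ι), t.card < s.card → 2 ≤ t.card →
      (t : Set ι).PairwiseDisjoint (fun i => (Y i).verts) →
      (∀ i ∈ t, Disjoint X'.verts (Y i).verts) → (∀ i ∈ t, HubLink X' (Y i)) →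
      ClusterBound X' Y t := fun X' t ht ht2 h1 h2 h3 => IH t.card (hm ▸ ht) ht2 h1 h2 h3 rfl
  by_cases hs2 : s.card = 2
  · exact clusterBound_of_card_eq_two hs2 hd hd₀ h
  have hs3 : 3 ≤ s.card := by omega
  by_cases hcc : ∀ i ∈ s, ∃ a b, X.IsHub a ∧ (Y i).IsHub b ∧ G.Adj a b
  · exact clusterBound_of_isHub hs3 hd hd₀ hcc
  push Not at hcc
  obtain ⟨i, his, hi⟩ := hcc
  by_cases hn : 3 * (s.card + 1) ≤ X.verts.card + ∑ i ∈ s, (Y i).verts.card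
  · obtain ⟨a, b, ha, hb, hab⟩ | ⟨A, B, w, hbr, e⟩ := (h i his).isHub_or_exists_bridge (hd₀ i his)
    · exact absurd hab (hi a b ha hb)
    · refine ClusterBound.of_subset (singleton_subset_iff.2 his) hd hd₀ (g := 2 / 3)
        (by simpa [← e] using hbr.gainBound) ?_
      have : ((3 * (s.card + 1) : ℕ) : ℝ) ≤ (X.verts.card + ∑ i ∈ s, (Y i).verts.card : ℕ) := by
        exact_mod_cast hn
      push_cast at this ⊢
      linarith
  by_cases hY : ∃ j ∈ s, 3 ≤ (Y j).verts.card
  · obtain ⟨j, hjs, hj⟩ := hY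
    have hcard := card_erase_of_mem hjs
    have hih := ih X (s.erase j) (by omega) (by omega) (hd.subset (by simp))
      (fun l hl => hd₀ l (mem_of_mem_erase hl)) fun l hl => h l (mem_of_mem_erase hl)
    refine ClusterBound.of_subset (erase_subset j s) hd hd₀ hih ?_
    have hsum := add_sum_erase s (fun i => (Y i).verts.card) hjs
    have hX := X.two_le_cast
    rw [← hsum] at hn ⊢
    rw [hcard]
    push_cast [Nat.cast_sub (by omega : 1 ≤ s.card)]
    obtain ⟨r, hr⟩ : ∃ r, r = ∑ i ∈ s.erase j, (Y i).verts.card := ⟨_, rfl⟩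
    rw [← hr] at hn
    have hr' : (∑ i ∈ s.erase j, ((Y i).verts.card : ℝ)) = r := by rw [hr]; push_cast; rfl
    have h1 : (3 : ℝ) ≤ (Y j).verts.card := by exact_mod_cast hj
    have h2 : (X.verts.card : ℝ) + ((Y j).verts.card + r) + 1 ≤ 3 * (s.card + 1) := by
      exact_mod_cast (by omega : X.verts.card + ((Y j).verts.card + r) + 1 ≤ 3 * (s.card + 1))
    have h3 : (0 : ℝ) ≤ r := by positivity
    have h4 : (3 : ℝ) ≤ s.card := by exact_mod_cast hs3
    rw [hr', div_mul_eq_mul_div, le_div_iff₀ (by linarith)]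
    nlinarith
  push Not at hY
  have hY2 : ∀ j ∈ s, (Y j).verts.card = 2 := fun j hj => by
    have := (Y j).two_le_card
    have := hY j hj
    omega
  have h' : ∀ j, ∃ a b, j ∈ s → a ∈ X.verts ∧ b ∈ (Y j).verts ∧ G.Adj a b := fun j => by
    by_cases hj : j ∈ s
    · obtain ⟨a, ha, b, hb, hab, -⟩ := h j hj
      exact ⟨a, b, fun _ => ⟨ha, hb, hab⟩⟩
    · exact ⟨X.ctr, X.ctr, fun h => absurd h hj⟩
  choose a b hab using h'
  obtain ⟨hai, hbi, habi⟩ := hab i his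
  have hhub : ¬ X.IsHub (a i) := fun H =>
    hi (a i) (b i) H (isHub_of_card_eq_two hbi (hY2 i his)) habi
  obtain ⟨hw, h3⟩ := three_le_card_of_not_isHub hai hhub
  rw [sum_congr rfl hY2, sum_const, smul_eq_mul] at hn
  exact clusterBound_of_leaf hs3 ih hd hd₀ hY2 (fun j hj => (hab j hj).1)
    (fun j hj => (hab j hj).2.1) (fun j hj => (hab j hj).2.2) hw h3 (by omega)
    ⟨i, mem_filter.2 ⟨his, rfl⟩⟩

end Star

end Clusters

section Partitions

open Finset

variable {V : Type} [DecidableEq V] {G : SimpleGraph V}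

/-- Families of pairwise disjoint stars. -/
def IsStarPacking (P : Finset (Star G)) : Prop := (P : Set (Star G)).PairwiseDisjoint Star.verts

namespace IsStarPacking

variable {P : Finset (Star G)}

theorem exists_insert (hP : IsStarPacking P) {Y : Star G}
    (hY : Disjoint Y.verts (P.biUnion Star.verts)) :
    ∃ P' : Finset (Star G), IsStarPacking P' ∧ P'.card = P.card + 1 ∧
      P'.biUnion Star.verts = Y.verts ∪ P.biUnion Star.verts := by
  classical
  rw [disjoint_biUnion_right] at hY
  have hYP : Y ∉ P := fun h => disjoint_left.1 (hY Y h) Y.ctr_mem Y.ctr_mem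
  refine ⟨insert Y P, ?_, card_insert_of_notMem hYP, biUnion_insert⟩
  rw [IsStarPacking, coe_insert, Set.pairwiseDisjoint_insert_of_notMem (by simpa using hYP)]
  exact ⟨hP, hY⟩

theorem exists_erase (hP : IsStarPacking P) {Z : Star G} (hZ : Z ∈ P) :
    ∃ P' ⊆ P, IsStarPacking P' ∧ P'.card + 1 = P.card ∧
      Disjoint Z.verts (P'.biUnion Star.verts) ∧
      P.biUnion Star.verts = Z.verts ∪ P'.biUnion Star.verts ∧ ∀ X ∈ P, X ≠ Z → X ∈ P' := by
  classical
  refine ⟨P.erase Z, erase_subset _ _, hP.subset (by simp), card_erase_add_one hZ, ?_, ?_,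
    fun X hX hne => mem_erase.2 ⟨hne, hX⟩⟩
  · rw [disjoint_biUnion_right]
    exact fun X hX => hP hZ (mem_of_mem_erase hX) (ne_of_mem_erase hX).symm
  · rw [← biUnion_insert, insert_erase hZ]

theorem exists_cover_insert (hP : IsStarPacking P) {v u : V} (hv : v ∉ P.biUnion Star.verts)
    (hvu : G.Adj v u) :
    ∃ P' : Finset (Star G), IsStarPacking P' ∧
      insert v (P.biUnion Star.verts) ⊆ P'.biUnion Star.verts := by
  by_cases hu : u ∈ P.biUnion Star.verts
  · obtain ⟨Z, hZ, huZ⟩ := mem_biUnion.1 hu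
    obtain ⟨P₁, -, hP₁, -, hdisj, hcov, -⟩ := hP.exists_erase hZ
    rw [hcov] at hv ⊢
    rw [mem_union, not_or] at hv
    by_cases hub : Z.IsHub u
    · obtain ⟨Y, rfl, hY⟩ := hub.exists_recenter
      rw [← hY] at hv hdisj ⊢
      have hvY : v ∉ insert Y.ctr Y.leaves := hv.1
      rw [mem_insert, not_or] at hvY
      have hverts : (Star.mk (G := G) Y.ctr (insert v Y.leaves) (insert_nonempty _ _)
          (by simp [Ne.symm hvY.1, Y.ctr_notMem])
          (by simpa [hvu.symm] using Y.adj)).verts = insert v Y.verts := by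
        simp only [Star.verts]
        rw [insert_comm]
      obtain ⟨P₂, hP₂, -, hcov₂⟩ := hP₁.exists_insert
        (hverts ▸ disjoint_insert_left.2 ⟨hv.2, hdisj⟩)
      refine ⟨P₂, hP₂, ?_⟩
      rw [hcov₂, hverts, insert_union]
    · obtain ⟨hul, h3⟩ := Star.three_le_card_of_not_isHub huZ hub
      have hverts := Star.verts_eraseLeaf Z h3 hul
      obtain ⟨P₂, hP₂, -, hcov₂⟩ := hP₁.exists_insert (Y := Z.eraseLeaf u h3)
        (hverts ▸ disjoint_of_subset_left (erase_subset _ _) hdisj)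
      have hverts' : (Star.mk (G := G) u {v} (by simp) (by simpa using hvu.ne')
        (by simpa using hvu.symm)).verts = {u, v} := rfl
      obtain ⟨P₃, hP₃, -, hcov₃⟩ := hP₂.exists_insert (Y := ⟨u, {v}, by simp,
        by simpa using hvu.ne', by simpa using hvu.symm⟩) (by
          rw [hcov₂, hverts, hverts', disjoint_insert_left, disjoint_singleton_left]
          simp only [mem_union, mem_erase, not_or]
          exact ⟨⟨by simp, disjoint_left.1 hdisj huZ⟩, ⟨fun h => hv.1 h.2, hv.2⟩⟩)
      refine ⟨P₃, hP₃, ?_⟩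
      rw [hcov₃, hcov₂, hverts, hverts']
      intro x
      by_cases hx : x = u <;> simp [hx]
  · have hverts : (Star.mk (G := G) v {u} (by simp) (by simpa using hvu.ne)
      (by simpa using hvu)).verts = {v, u} := rfl
    obtain ⟨P', hP', -, hcov⟩ := hP.exists_insert (Y := ⟨v, {u}, by simp,
      by simpa using hvu.ne, by simpa using hvu⟩) (by
        rw [hverts, disjoint_insert_left, disjoint_singleton_left]
        exact ⟨hv, hu⟩)
    refine ⟨P', hP', ?_⟩
    rw [hcov, hverts]
    intro x
    simp
    tauto

end IsStarPacking

/-- A finite graph without isolated vertices has a spanning family of disjoint stars. -/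
theorem exists_isStarPacking_cover [Fintype V] (h : ∀ v, ∃ u, G.Adj v u) :
    ∃ P : Finset (Star G), IsStarPacking P ∧ P.biUnion Star.verts = univ := by
  have aux : ∀ T : Finset V, ∃ P : Finset (Star G), IsStarPacking P ∧
      T ⊆ P.biUnion Star.verts := by
    intro T
    induction T using Finset.induction_on with
    | empty => exact ⟨∅, by simp [IsStarPacking], by simp⟩
    | insert v T _ ih =>
      obtain ⟨P, hP, hT⟩ := ih
      by_cases hv : v ∈ P.biUnion Star.verts
      · exact ⟨P, hP, insert_subset hv hT⟩
      · obtain ⟨u, hu⟩ := h v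
        obtain ⟨P', hP', hT'⟩ := hP.exists_cover_insert hv hu
        exact ⟨P', hP', (insert_subset_insert v hT).trans hT'⟩
  obtain ⟨P, hP, hT⟩ := aux univ
  exact ⟨P, hP, univ_subset_iff.1 hT⟩

/-- Spanning families of pairwise disjoint stars. -/
structure IsStarPartition [Fintype V] (P : Finset (Star G)) : Prop where
  packing : IsStarPacking P
  cover : P.biUnion Star.verts = univ

namespace IsStarPartition

variable [Fintype V] {P : Finset (Star G)}

theorem sum_card (hP : IsStarPartition P) : ∑ X ∈ P, X.verts.card = Fintype.card V := by
  rw [← card_univ, ← hP.cover, card_biUnion hP.packing]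

theorem two_mul_card_le (hP : IsStarPartition P) : 2 * P.card ≤ Fintype.card V := by
  rw [← hP.sum_card, mul_comm]
  exact card_nsmul_le_sum P (fun X => X.verts.card) 2 fun X _ => Star.two_le_card X

/-- In a spanning family with as many stars as possible, all links involve a hub. -/
theorem hubLink (hP : IsStarPartition P)
    (hmax : ∀ P' : Finset (Star G), IsStarPartition P' → P'.card ≤ P.card) {X Y : Star G}
    (hX : X ∈ P) (hY : Y ∈ P) (hXY : X ≠ Y) {a b : V} (ha : a ∈ X.verts) (hb : b ∈ Y.verts)
    (hab : G.Adj a b) : X.HubLink Y := by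
  by_contra hno
  have haX : ¬ X.IsHub a := fun h => hno ⟨a, ha, b, hb, hab, Or.inl h⟩
  have hbY : ¬ Y.IsHub b := fun h => hno ⟨a, ha, b, hb, hab, Or.inr h⟩
  obtain ⟨hal, hX3⟩ := Star.three_le_card_of_not_isHub ha haX
  obtain ⟨hbl, hY3⟩ := Star.three_le_card_of_not_isHub hb hbY
  have hXv := Star.verts_eraseLeaf X hX3 hal
  have hYv := Star.verts_eraseLeaf Y hY3 hbl
  have hdXY : Disjoint X.verts Y.verts := hP.packing hX hY hXY
  obtain ⟨P₁, -, hP₁, hc₁, hd₁, hcov₁, hmem⟩ := hP.packing.exists_erase hX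
  obtain ⟨P₂, -, hP₂, hc₂, hd₂, hcov₂, -⟩ := hP₁.exists_erase (hmem Y hY hXY.symm)
  rw [hcov₂, disjoint_union_right] at hd₁
  obtain ⟨P₃, hP₃, hc₃, hcov₃⟩ := hP₂.exists_insert (Y := X.eraseLeaf a hX3)
    (hXv ▸ disjoint_of_subset_left (erase_subset _ _) hd₁.2)
  obtain ⟨P₄, hP₄, hc₄, hcov₄⟩ := hP₃.exists_insert (Y := Y.eraseLeaf b hY3) (by
    rw [hcov₃, hXv, hYv, disjoint_union_right]
    exact ⟨disjoint_of_subset_left (erase_subset _ _)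
      (disjoint_of_subset_right (erase_subset _ _) hdXY.symm),
      disjoint_of_subset_left (erase_subset _ _) hd₂⟩)
  have hverts : (Star.mk (G := G) a {b} (by simp) (by simpa using hab.ne)
    (by simpa using hab)).verts = {a, b} := rfl
  obtain ⟨P₅, hP₅, hc₅, hcov₅⟩ := hP₄.exists_insert (Y := ⟨a, {b}, by simp,
    by simpa using hab.ne, by simpa using hab⟩) (by
      rw [hcov₄, hcov₃, hverts, hXv, hYv, disjoint_insert_left, disjoint_singleton_left]
      simp only [mem_union, mem_erase, not_or]
      exact ⟨⟨fun h => disjoint_left.1 hdXY ha h.2, by simp, disjoint_left.1 hd₁.2 ha⟩,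
        ⟨by simp, fun h => disjoint_left.1 hdXY h.2 hb, disjoint_left.1 hd₂ hb⟩⟩)
  have hcover : P₅.biUnion Star.verts = univ := by
    rw [← univ_subset_iff, ← hP.cover, hcov₁, hcov₂, hcov₅, hcov₄, hcov₃, hverts, hXv, hYv]
    intro x
    by_cases hxa : x = a <;> by_cases hxb : x = b <;> simp [hxa, hxb]
    tauto
  have := hmax P₅ ⟨hP₅, hcover⟩
  omega

theorem exists_max (h : ∀ v, ∃ u, G.Adj v u) :
    ∃ P : Finset (Star G), IsStarPartition P ∧
      ∀ P' : Finset (Star G), IsStarPartition P' → P'.card ≤ P.card := by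
  obtain ⟨P₀, hP₀, hc₀⟩ := exists_isStarPacking_cover h
  obtain ⟨P, hP, hmin⟩ := WellFounded.has_min
    (measure fun P : Finset (Star G) => Fintype.card V - P.card).wf {P | IsStarPartition P}
    ⟨P₀, hP₀, hc₀⟩
  refine ⟨P, hP, fun P' hP' => ?_⟩
  have h1 : ¬ (Fintype.card V - P'.card < Fintype.card V - P.card) := hmin P' hP'
  have h2 := hP'.two_mul_card_le
  have h3 := IsStarPartition.two_mul_card_le hP
  omega

end IsStarPartition

end Partitions

section LinkGraph

open Finset

variable {V : Type} [Fintype V] [DecidableEq V] {G : SimpleGraph V}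

/-- The graph whose vertices are the stars of a family, two being adjacent if an edge of `G`
joins them. -/
def linkGraph (P : Finset (Star G)) : SimpleGraph P where
  Adj X Y := X ≠ Y ∧ ∃ a ∈ X.1.verts, ∃ b ∈ Y.1.verts, G.Adj a b
  symm := ⟨fun _ _ ⟨h, a, ha, b, hb, hab⟩ => ⟨h.symm, b, hb, a, ha, hab.symm⟩⟩
  loopless := ⟨fun _ h => h.1 rfl⟩

theorem IsStarPartition.exists_linkGraph_adj {P : Finset (Star G)} (hP : IsStarPartition P)
    (hG : G.Connected) (h2 : 2 ≤ P.card) (X : P) : ∃ Y, (linkGraph P).Adj X Y := by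
  obtain ⟨Y, hY, hYX⟩ := exists_mem_ne h2 X.1
  have hd : Disjoint X.1.verts Y.verts := hP.packing X.2 hY hYX.symm
  obtain ⟨p⟩ := hG.preconnected X.1.ctr Y.ctr
  obtain ⟨d, -, hd1, hd2⟩ := p.exists_boundary_dart (X.1.verts : Set V) X.1.ctr_mem
    (fun h => disjoint_left.1 hd h Y.ctr_mem)
  obtain ⟨Z, hZ, hdZ⟩ := mem_biUnion.1 (hP.cover.symm ▸ mem_univ d.snd)
  refine ⟨⟨Z, hZ⟩, ?_, d.fst, hd1, d.snd, hdZ, d.adj⟩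
  rintro rfl
  exact hd2 hdZ

variable [DecidableRel G.Adj]

theorem gainBound_biUnion_linkGraph [DecidableEq (Star G)] {P : Finset (Star G)}
    (hP : IsStarPacking P) (hlink : ∀ X Y, (linkGraph P).Adj X Y → X.1.HubLink Y.1)
    (Z : Star (linkGraph P)) {N : ℕ} (hN : ∑ X ∈ Z.verts, X.1.verts.card ≤ N)
    (h : 3 ≤ Z.verts.card ∨ ∑ X ∈ Z.verts, X.1.verts.card + 4 ≤ N) :
    GainBound G (Z.verts.biUnion fun X => X.1.verts) (2 * Z.verts.card / N) := by
  have hd : ∀ s : Finset P, (s : Set P).PairwiseDisjoint fun X => X.1.verts :=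
    fun s X _ Y _ hXY => hP X.2 Y.2 fun h => hXY (Subtype.ext h)
  have hd₀ : ∀ X ∈ Z.leaves, Disjoint Z.ctr.1.verts X.1.verts := fun X hX =>
    hd univ (by simp) (by simp) (Z.adj X hX).ne
  have hl : ∀ X ∈ Z.leaves, Z.ctr.1.HubLink X.1 := fun X hX => hlink _ _ (Z.adj X hX)
  have hsum : ∑ X ∈ Z.verts, X.1.verts.card =
      Z.ctr.1.verts.card + ∑ X ∈ Z.leaves, X.1.verts.card := sum_insert Z.ctr_notMem
  have hpos := Z.ctr.1.two_le_card
  have hc := Z.card_verts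
  have hu : (Z.verts.biUnion fun X => X.1.verts) =
      Z.ctr.1.verts ∪ Z.leaves.biUnion fun X => X.1.verts := biUnion_insert
  rw [hu]
  rw [hsum] at hN h
  rcases Nat.lt_or_ge Z.leaves.card 2 with h1 | h2
  · obtain ⟨X, hX⟩ := card_eq_one.1 (show Z.leaves.card = 1 by
      have := Z.nonempty.card_pos
      omega)
    have hXm : X ∈ Z.leaves := by simp [hX]
    rw [hX, sum_singleton] at hN h
    rw [hX, card_singleton] at hc
    rw [hX, singleton_biUnion]
    refine ((hl X hXm).gainBound (hd₀ X hXm)).mono ?_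
    rw [hc]
    have h4 : ((Z.ctr.1.verts.card + X.1.verts.card : ℕ) : ℝ) + 4 ≤ N := by
      exact_mod_cast h.resolve_left (by omega)
    have h0 : (0 : ℝ) ≤ (Z.ctr.1.verts.card + X.1.verts.card : ℕ) := by positivity
    rw [div_le_div_iff₀ (by linarith) (by linarith)]
    norm_num
    push_cast at h4
    linarith
  · refine GainBound.mono (Star.clusterBound h2 (hd _) hd₀ hl) ?_
    rw [hc, Nat.cast_succ]
    refine div_le_div_of_nonneg_left (by positivity) ?_ (by exact_mod_cast hN)
    exact_mod_cast (by omega)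

theorem IsStarPartition.gainBound_of_three_le {P : Finset (Star G)} (hP : IsStarPartition P)
    (hG : G.Connected) (hlink : ∀ X Y, (linkGraph P).Adj X Y → X.1.HubLink Y.1)
    (h3 : 3 ≤ P.card) : GainBound G univ (2 * P.card / Fintype.card V) := by
  classical
  obtain ⟨Q, hQ, hQc⟩ := exists_isStarPacking_cover (G := linkGraph P)
    (hP.exists_linkGraph_adj hG (by omega))
  have hd : ((univ : Finset P) : Set P).PairwiseDisjoint fun X => X.1.verts :=
    fun X _ Y _ hXY => hP.packing X.2 Y.2 fun h => hXY (Subtype.ext h)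
  have hsum : ∑ Z ∈ Q, ∑ X ∈ Z.verts, X.1.verts.card = Fintype.card V := by
    rw [← sum_biUnion hQ, hQc, ← hP.sum_card, ← sum_coe_sort P]
  have hsum' : ∑ Z ∈ Q, Z.verts.card = P.card := by
    rw [← card_biUnion hQ, hQc, card_univ, Fintype.card_coe]
  have h4 : ∀ Z : Star (linkGraph P), 4 ≤ ∑ X ∈ Z.verts, X.1.verts.card := fun Z => by
    have h1 := card_nsmul_le_sum Z.verts (fun X => X.1.verts.card) 2 fun X _ => X.1.two_le_card
    have h2 := Z.two_le_card
    rw [smul_eq_mul] at h1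
    omega
  have hblock : ∀ Z ∈ Q, GainBound G (Z.verts.biUnion fun X => X.1.verts)
      (2 * Z.verts.card / Fintype.card V) := by
    intro Z hZ
    refine gainBound_biUnion_linkGraph hP.packing hlink Z ?_ ?_
    · rw [← hsum]
      exact single_le_sum (f := fun Z : Star (linkGraph P) => ∑ X ∈ Z.verts, X.1.verts.card)
        (fun _ _ => Nat.zero_le _) hZ
    · by_cases hone : ∃ Z' ∈ Q, Z' ≠ Z
      · obtain ⟨Z', hZ', hne⟩ := hone
        right
        have hle := sum_le_sum_of_subset (f := fun Z : Star (linkGraph P) =>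
          ∑ X ∈ Z.verts, X.1.verts.card) (insert_subset hZ (singleton_subset_iff.2 hZ'))
        rw [sum_pair hne.symm, hsum] at hle
        have := h4 Z'
        omega
      · left
        push Not at hone
        rw [eq_singleton_iff_unique_mem.2 ⟨hZ, hone⟩, sum_singleton] at hsum'
        omega
  have hfin := GainBound.biUnion (s := Q) (S := fun Z => Z.verts.biUnion fun X => X.1.verts) (by
    intro Z hZ Z' hZ' hne
    simp only [Function.onFun, disjoint_biUnion_left, disjoint_biUnion_right]
    intro X hX Y hY
    refine hd (by simp) (by simp) fun h => ?_
    rw [h] at hY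
    exact disjoint_left.1 (hQ hZ hZ' hne) hY hX) hblock
  have hcov : (Q.biUnion fun Z => Z.verts.biUnion fun X => X.1.verts) = univ := by
    rw [← biUnion_biUnion, hQc, ← hP.cover]
    ext
    simp
  rw [hcov] at hfin
  refine hfin.mono (le_of_eq ?_)
  rw [← sum_div, ← mul_sum, ← hsum']
  push_cast
  rfl

omit [Fintype V] [DecidableRel G.Adj] in
theorem Star.dist_ctr_le {X : Star G} {u : V} (hu : u ∈ X.verts) : G.dist u X.ctr ≤ 1 := by
  rcases mem_insert.1 hu with rfl | hu
  · simp
  · exact (SimpleGraph.dist_eq_one_iff_adj.2 (X.adj u hu).symm).le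

omit [DecidableRel G.Adj] in
/-- If the stars of a partition into at most two stars have linked centres, the diameter is at
most three. -/
theorem diam_le_three_of_ctr_adj {X Y : Star G} (hG : G.Connected)
    (h : X.verts ∪ Y.verts = univ) (hXY : G.dist X.ctr Y.ctr ≤ 1) : G.diam ≤ 3 := by
  have := hG.nonempty
  obtain ⟨u, v, huv⟩ := G.exists_dist_eq_diam
  have hu : u ∈ X.verts ∪ Y.verts := h ▸ mem_univ u
  have hv : v ∈ X.verts ∪ Y.verts := h ▸ mem_univ v
  have hYX : G.dist Y.ctr X.ctr ≤ 1 := by rwa [SimpleGraph.dist_comm]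
  have hc : ∀ Z : Star G, G.dist Z.ctr Z.ctr ≤ 1 := by simp
  have key : ∀ Z W : Star G, G.dist Z.ctr W.ctr ≤ 1 → u ∈ Z.verts → v ∈ W.verts →
      G.diam ≤ 3 := by
    intro Z W hZW hu hv
    have h1 := Star.dist_ctr_le hu
    have h2 := Star.dist_ctr_le hv
    rw [SimpleGraph.dist_comm] at h2
    have h3 := hG.dist_triangle (u := u) (v := Z.ctr) (w := v)
    have h4 := hG.dist_triangle (u := Z.ctr) (v := W.ctr) (w := v)
    omega
  rcases mem_union.1 hu with hu | hu <;> rcases mem_union.1 hv with hv | hv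
  exacts [key X X (hc _) hu hv, key X Y hXY hu hv, key Y X hYX hu hv, key Y Y (hc _) hu hv]

theorem IsStarPartition.two_le_card_and_gainBound {P : Finset (Star G)}
    (hP : IsStarPartition P) (hG : G.Connected)
    (hlink : ∀ X Y, (linkGraph P).Adj X Y → X.1.HubLink Y.1) (hn : 6 ≤ Fintype.card V)
    (hdiam : 4 ≤ G.diam) :
    2 ≤ P.card ∧ GainBound G univ (2 * P.card / Fintype.card V) := by
  have h2 : 2 ≤ P.card := by
    by_contra hlt
    have hsum := hP.sum_card
    have hne : P.card ≠ 0 := fun h => by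
      rw [card_eq_zero.1 h] at hsum
      simp at hsum
      omega
    obtain ⟨X, rfl⟩ := card_eq_one.1 (show P.card = 1 by omega)
    have hcov := hP.cover
    rw [singleton_biUnion] at hcov
    have := diam_le_three_of_ctr_adj (X := X) (Y := X) hG (by rw [union_self, hcov]) (by simp)
    omega
  refine ⟨h2, ?_⟩
  rcases h2.lt_or_eq with h3 | h2'
  · exact hP.gainBound_of_three_le hG hlink h3
  classical
  obtain ⟨X, Y, hXY, rfl⟩ := card_eq_two.1 h2'.symm
  have hX : X ∈ ({X, Y} : Finset (Star G)) := by simp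
  have hY : Y ∈ ({X, Y} : Finset (Star G)) := by simp
  have hd : Disjoint X.verts Y.verts := hP.packing hX hY hXY
  have hcov := hP.cover
  rw [biUnion_insert, singleton_biUnion] at hcov
  obtain ⟨⟨Z, hZ⟩, hadj⟩ := hP.exists_linkGraph_adj hG h2 ⟨X, hX⟩
  have hl := hlink _ _ hadj
  have hZY : Z = Y := by
    rcases mem_insert.1 hZ with rfl | hZ
    · exact absurd rfl hadj.1
    · exact mem_singleton.1 hZ
  subst hZY
  rcases hl.isHub_or_exists_bridge hd with ⟨a, b, ha, hb, hab⟩ | ⟨A, B, w, h, hv⟩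
  · obtain ⟨X', rfl, hX'⟩ := ha.exists_recenter
    obtain ⟨Y', rfl, hY'⟩ := hb.exists_recenter
    have := diam_le_three_of_ctr_adj (X := X') (Y := Y') hG (by rw [hX', hY', hcov])
      (SimpleGraph.dist_eq_one_iff_adj.2 hab).le
    omega
  · have hb := h.gainBound
    rw [hv, hcov] at hb
    refine hb.mono ?_
    rw [← h2']
    have : (6 : ℝ) ≤ Fintype.card V := by exact_mod_cast hn
    rw [div_le_div_iff₀ (by linarith) (by norm_num)]
    norm_num
    linarith

end LinkGraph

section LaplacianSums

open Finset

theorem exists_finset_of_le_map {α β : Type} [DecidableEq α] (f : α → β) (m : Multiset β)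
    (s : Finset α) (h : m ≤ s.val.map f) : ∃ I ⊆ s, I.val.map f = m := by
  induction m using Multiset.induction_on generalizing s with
  | empty => exact ⟨∅, empty_subset _, rfl⟩
  | cons b m ih =>
    obtain ⟨a, ha, rfl⟩ := Multiset.mem_map.1 (Multiset.mem_of_le h (Multiset.mem_cons_self b m))
    have ha' : a ∉ s.erase a := notMem_erase a s
    rw [← insert_erase (show a ∈ s from ha), insert_val_of_notMem ha', Multiset.map_cons,
      Multiset.cons_le_cons_iff] at h
    obtain ⟨I, hI, hm⟩ := ih _ h
    refine ⟨insert a I, insert_subset ha (hI.trans (erase_subset _ _)), ?_⟩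
    rw [insert_val_of_notMem fun h => ha' (hI h), Multiset.map_cons, hm]

variable {V : Type} [Fintype V] [DecidableEq V] {G : SimpleGraph V} [DecidableRel G.Adj]

omit [DecidableEq V] in
theorem edgeCount_univ : edgeCount G univ = G.edgeFinset.card := by
  have h : ∀ a, ∑ b, (if G.Adj a b then (1 : ℝ) else 0) = G.degree a := fun a => by
    rw [G.degree_eq_sum_if_adj (R := ℝ)]
  unfold edgeCount
  rw [sum_congr rfl fun a _ => h a, ← Nat.cast_sum, G.sum_degrees_eq_twice_card_edges]
  push_cast
  ring

theorem exists_Sk_eq_sum_energy {k : ℕ} (hk : k ≤ Fintype.card V) :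
    ∃ U : V → V → ℝ, IsONB U ∧ ∃ I : Finset V, I.card = k ∧
      Sk G k = ∑ i ∈ I, energy G univ (U i) := by
  have hH := G.isHermitian_lapMatrix ℝ
  have hspec : lapSpectrum G = (univ : Finset V).val.map hH.eigenvalues :=
    hH.roots_charpoly_eq_eigenvalues
  have hle : ((((lapSpectrum G).sort (· ≤ ·)).reverse.take k : List ℝ) : Multiset ℝ) ≤
      (univ : Finset V).val.map hH.eigenvalues := by
    rw [← hspec]
    conv_rhs => rw [← Multiset.sort_eq (lapSpectrum G) (· ≤ ·), ← Multiset.coe_reverse]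
    exact (List.take_sublist _ _).subperm
  obtain ⟨I, -, hI⟩ := exists_finset_of_le_map _ _ _ hle
  refine ⟨_, (exists_eigenONB _ hH).1, I, ?_, ?_⟩
  · have := congrArg Multiset.card hI
    rw [Multiset.card_map, Multiset.coe_card, List.length_take, List.length_reverse,
      Multiset.length_sort, hspec, Multiset.card_map] at this
    rw [card_def, this]
    simpa using hk
  · have hE : ∀ i, hH.eigenvalues i = energy G univ fun v => hH.eigenvectorBasis i v := fun i => by
      rw [hH.eigenvalues_eq, energy, ← G.lapMatrix_toLinearMap₂' ℝ, Matrix.toLinearMap₂'_apply']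
      simp
    rw [Sk, ← Multiset.sum_coe, ← hI]
    exact sum_congr rfl fun i _ => hE i

theorem Sk_le_of_gainBound {g : ℝ} (h : GainBound G univ g) {k : ℕ} (hk : k ≤ Fintype.card V) :
    Sk G k ≤ 2 * k + 2 * G.edgeFinset.card - Fintype.card V - g := by
  obtain ⟨U, hU, I, rfl, hS⟩ := exists_Sk_eq_sum_energy (G := G) hk
  have := h U hU I
  simp only [hU.sum_sq, edgeCount_univ, card_univ, sum_sub_distrib, sum_const, nsmul_eq_mul,
    ← hS] at this
  linarith

theorem Sk_le_of_hasCert {t : ℝ} (h : HasCert G univ 1 t) {k : ℕ} (hk : k ≤ Fintype.card V) :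
    Sk G k ≤ 2 * G.edgeFinset.card - Fintype.card V + k + t := by
  obtain ⟨U, hU, I, rfl, hS⟩ := exists_Sk_eq_sum_energy (G := G) hk
  obtain ⟨q, hq, htr, hle⟩ := h
  have h1 := hasTr_energy (G := G) univ U hU
  rw [edgeCount_univ, ← sum_add_sum_compl I, ← hS] at h1
  have h2 : ∑ i ∈ Iᶜ, q (U i) ≤ t := by
    rw [← htr U hU]
    exact sum_le_univ_sum_of_nonneg fun i => hq _
  have h3 : ∑ i ∈ Iᶜ, (1 : ℝ) ≤ ∑ i ∈ Iᶜ, (energy G univ (U i) + q (U i)) :=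
    sum_le_sum fun i _ => by simpa [hU.sum_sq] using hle (U i)
  rw [sum_const, card_compl, nsmul_eq_mul, mul_one, Nat.cast_sub hk, sum_add_distrib] at h3
  linarith

theorem Sk_le_two_mul_card_edgeFinset {k : ℕ} (hk : k ≤ Fintype.card V) :
    Sk G k ≤ 2 * G.edgeFinset.card := by
  obtain ⟨U, hU, I, -, hS⟩ := exists_Sk_eq_sum_energy (G := G) hk
  rw [hS, ← edgeCount_univ, ← hasTr_energy (G := G) univ U hU]
  exact sum_le_univ_sum_of_nonneg fun i => energy_nonneg G _ _

namespace IsStarPartition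

variable {P : Finset (Star G)}

theorem hasCert (hP : IsStarPartition P) : HasCert G univ 1 P.card := by
  have := HasCert.biUnion (r := 1) hP.packing fun X _ => X.hasCert
  simpa [hP.cover] using this

theorem exists_hasCert_of_card (hP : IsStarPartition P) {X Y : Star G} (hX : X ∈ P) (hY : Y ∈ P)
    (hXY : X ≠ Y) (hl : X.HubLink Y) (hn : Fintype.card V = 2 * P.card + 1)
    (hn7 : 7 ≤ Fintype.card V) :
    ∃ δ : ℝ, 1 / (Fintype.card V : ℝ) ≤ δ ∧ HasCert G univ 1 (P.card - δ) := by
  classical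
  obtain ⟨P₁, -, hP₁, hc₁, hd₁, hcov₁, hmem⟩ := hP.packing.exists_erase hX
  obtain ⟨P₂, -, hP₂, hc₂, hd₂, hcov₂, -⟩ := hP₁.exists_erase (hmem Y hY hXY.symm)
  rw [hcov₂, disjoint_union_right] at hd₁
  have hcov := hP.cover
  rw [hcov₁, hcov₂, ← union_assoc] at hcov
  have hd : Disjoint (X.verts ∪ Y.verts) (P₂.biUnion Star.verts) :=
    disjoint_union_left.2 ⟨hd₁.2, hd₂⟩
  have hN : (7 : ℝ) ≤ Fintype.card V := by exact_mod_cast hn7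
  suffices h : ∃ δ : ℝ, 1 / (Fintype.card V : ℝ) ≤ δ ∧
      HasCert G (X.verts ∪ Y.verts) 1 (2 - δ) by
    obtain ⟨δ, hδ, h⟩ := h
    have hR := HasCert.biUnion (r := 1) hP₂ fun X _ => X.hasCert
    have := h.union hR hd
    rw [hcov] at this
    refine ⟨δ, hδ, ?_⟩
    convert this using 1
    rw [← hc₁, ← hc₂]
    simp
    ring
  rcases hl.isHub_or_exists_bridge hd₁.1 with ⟨a, b, ha, hb, hab⟩ | ⟨A, B, w, h, hv⟩
  · obtain ⟨X', rfl, hX'⟩ := ha.exists_recenter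
    obtain ⟨Y', rfl, hY'⟩ := hb.exists_recenter
    rw [← hX', ← hY'] at hd₁ ⊢
    refine ⟨_, ?_, Star.hasCert_pair hd₁.1 hab rfl⟩
    have hcard : ∀ Z : Star G, 1 / (Fintype.card V : ℝ) ≤ 1 / Z.verts.card ∧
        1 / (Z.verts.card : ℝ) ≤ 1 / 2 := fun Z => by
      have h1 := Z.two_le_cast
      have h2 : (Z.verts.card : ℝ) ≤ Fintype.card V := by exact_mod_cast card_le_univ _
      exact ⟨one_div_le_one_div_of_le (by linarith) h2, one_div_le_one_div_of_le (by norm_num) h1⟩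
    have h1 := hcard X'
    have h2 := hcard Y'
    have h0 : 0 < 1 / (Fintype.card V : ℝ) := by positivity
    generalize 1 / (Fintype.card V : ℝ) = r at *
    generalize 1 / (X'.verts.card : ℝ) = s at *
    generalize 1 / (Y'.verts.card : ℝ) = t at *
    rw [le_div_iff₀ (by linarith)]
    nlinarith
  · rw [← hv]
    refine ⟨1 / 7, one_div_le_one_div_of_le (by norm_num) hN, ?_⟩
    have hcard : (X.verts ∪ Y.verts).card + 2 * P₂.card ≤ Fintype.card V := by
      rw [← card_univ, ← hcov, card_union_of_disjoint hd, card_biUnion hP₂, mul_comm]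
      exact Nat.add_le_add_left
        (card_nsmul_le_sum P₂ (fun X => X.verts.card) 2 fun X _ => X.two_le_card) _
    rw [← hv, h.card_verts] at hcard
    have hA := A.two_le_card
    have hB := B.two_le_card
    have := h.hasCert_two_two (by omega) (by omega)
    norm_num at this ⊢
    exact this

end IsStarPartition

end LaplacianSums

end LapPaper

namespace LapPaper

/-- Every tree `T` with `n ≥ 6` vertices and diameter at least `4`
satisfies `S_k(T) ≤ n - 2 + 2k - 2k/n` for every `1 ≤ k ≤ n`. -/
theorem Sk_le_of_diam_ge_four {V : Type} [Fintype V] [DecidableEq V]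
    (T : SimpleGraph V) [DecidableRel T.Adj] (n : ℕ) (hcard : Fintype.card V = n)
    (hn : 6 ≤ n) (hT : T.IsTree) (hdiam : 4 ≤ T.diam)
    (k : ℕ) (hk1 : 1 ≤ k) (hkn : k ≤ n) :
    Sk T k ≤ (n : ℝ) - 2 + 2 * k - 2 * k / n := by
  subst hcard
  have hG := hT.connected
  have hnt : Nontrivial V := Fintype.one_lt_card_iff_nontrivial.1 (by omega)
  obtain ⟨P, hP, hmax⟩ := IsStarPartition.exists_max (G := T)
    fun v => hG.preconnected.exists_adj_of_nontrivial v
  have hlink : ∀ X Y, (linkGraph P).Adj X Y → X.1.HubLink Y.1 := by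
    rintro X Y ⟨hne, a, ha, b, hb, hab⟩
    exact hP.hubLink hmax X.2 Y.2 (fun h => hne (Subtype.ext h)) ha hb hab
  obtain ⟨hp2, hgain⟩ := hP.two_le_card_and_gainBound hG hlink hn hdiam
  have hpn := hP.two_mul_card_le
  have hE : (T.edgeFinset.card : ℝ) = Fintype.card V - 1 := by
    rw [← hT.card_edgeFinset]
    push_cast
    ring
  have hnR : (6 : ℝ) ≤ Fintype.card V := by exact_mod_cast hn
  set n : ℝ := (Fintype.card V : ℝ) with hn_def
  have hn0 : 0 < n := by linarith
  rcases le_or_gt k P.card with hkp | hkp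
  · have h1 := Sk_le_of_gainBound hgain hkn
    have h2 : 2 * (k : ℝ) / n ≤ 2 * P.card / n := by
      gcongr
    rw [hE] at h1
    linarith
  have h1 := Sk_le_of_hasCert hP.hasCert hkn
  have h2 := Sk_le_two_mul_card_edgeFinset (G := T) hkn
  rw [hE] at h1 h2
  have hkp' : (P.card : ℝ) + 1 ≤ k := by exact_mod_cast hkp
  rcases le_or_gt (2 * k) (Fintype.card V) with hkn2 | hkn2
  · have h3 : 2 * (k : ℝ) / n ≤ 1 := by
      rw [div_le_one hn0]
      rw [hn_def]
      exact_mod_cast hkn2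
    linarith
  rcases Nat.lt_or_ge (Fintype.card V + 1) (2 * k) with hkn3 | hkn3
  · have h3 : n + 2 ≤ 2 * k := by
      rw [hn_def]
      exact_mod_cast hkn3
    have h4 : 2 * (k : ℝ) / n ≤ 2 * k - n := by
      rw [div_le_iff₀ hn0]
      nlinarith
    linarith
  have hnk : Fintype.card V + 1 = 2 * k := by omega
  have hnkR : n + 1 = 2 * k := by
    rw [hn_def]
    exact_mod_cast hnk
  have h4 : 2 * (k : ℝ) / n = 1 + 1 / n := by
    rw [← hnkR]
    field_simp
  have h5 : 1 / n ≤ 1 := by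
    rw [div_le_one hn0]
    linarith
  rcases Nat.lt_or_ge (P.card + 1) k with hpk | hpk
  · have : (P.card : ℝ) + 2 ≤ k := by exact_mod_cast hpk
    linarith
  · obtain ⟨X, hX⟩ := Finset.card_pos.1 (show 0 < P.card by omega)
    obtain ⟨Y, hXY⟩ := hP.exists_linkGraph_adj hG hp2 ⟨X, hX⟩
    obtain ⟨δ, hδ, hC⟩ := hP.exists_hasCert_of_card hX Y.2 (fun h => hXY.1 (Subtype.ext h))
      (hlink _ _ hXY) (by omega) (by omega)
    have h6 := Sk_le_of_hasCert hC hkn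
    rw [hE] at h6
    have : (P.card : ℝ) + 1 = k := by exact_mod_cast le_antisymm hkp hpk
    linarith

end LapPaper
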